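/- Every minimal Cantor dynamical system of finite topological rank d with d > 1 is expansive. -/

import Mathlib

open MeasureTheory

/-- A Bratteli diagram. -/
structure BratteliDiagram where
  V : ℕ → Type
  E : ℕ → Type
  fintypeV : ∀ n, Fintype (V n)
  fintypeE : ∀ n, Fintype (E n)
  nonemptyV : ∀ n, Nonempty (V n)
  nonemptyE : ∀ n, Nonempty (E n)
  root_subsingleton : ∀ v w : V 0, v = w
  src : ∀ n, E n → V n
  rng : ∀ n, E n → V (n + 1)
  src_surj : ∀ n, Function.Surjective (src n)
  rng_surj : ∀ n, Function.Surjective (rng n)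

attribute [instance] BratteliDiagram.fintypeV BratteliDiagram.fintypeE
  BratteliDiagram.nonemptyV BratteliDiagram.nonemptyE

namespace BratteliDiagram

variable (B : BratteliDiagram)

instance (n : ℕ) : TopologicalSpace (B.E n) := ⊥

/-- The path space `X_B` of a Bratteli diagram. -/
def PathSpace : Type :=
  { x : ∀ n, B.E n // ∀ n, B.rng n (x n) = B.src (n + 1) (x (n + 1)) }

instance : TopologicalSpace B.PathSpace := by unfold PathSpace; infer_instance

noncomputable instance : MeasurableSpace B.PathSpace := borel _

/-- The vertex at level `n` through which a path passes. -/
def endVtx (n : ℕ) (x : B.PathSpace) : B.V n := B.src n (x.1 n)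

/-- The cylinder set of paths agreeing with `x` on the first `n` edges. -/
def cyl (n : ℕ) (x : B.PathSpace) : Set B.PathSpace := { y | ∀ i < n, y.1 i = x.1 i }

/-- Tail equivalence of paths. -/
def tailEq (x y : B.PathSpace) : Prop := ∃ N, ∀ n, N ≤ n → x.1 n = y.1 n

/-- The tail equivalence relation is aperiodic: all classes are infinite. -/
def TailAperiodic : Prop := ∀ x : B.PathSpace, { y | B.tailEq x y }.Infinite

/-- A measure is invariant for the tail equivalence relation if any two
cylinder sets ending at the same vertex have equal measure. -/
def TailInvariant (μ : Measure B.PathSpace) : Prop :=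
  ∀ (n : ℕ) (x y : B.PathSpace), B.endVtx n x = B.endVtx n y →
    μ (B.cyl n x) = μ (B.cyl n y)

/-- Ergodicity with respect to the tail equivalence relation. -/
def TailErgodic (μ : Measure B.PathSpace) : Prop :=
  ∀ S : Set B.PathSpace, MeasurableSet S →
    (∀ x y, B.tailEq x y → (x ∈ S ↔ y ∈ S)) → μ S = 0 ∨ μ Sᶜ = 0

/-- The type of finite paths from the root vertex to `v`. -/
def FinPathTo : ∀ n, B.V n → Type
  | 0, _ => PUnit
  | n + 1, v => Σ e : { e : B.E n // B.rng n e = v }, FinPathTo n (B.src n e.1)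

/-- The height `h_v^{(n)}`: the number of finite paths from the root to `v`. -/
noncomputable def height (n : ℕ) (v : B.V n) : ℕ := Nat.card (B.FinPathTo n v)

/-- The number of edges from `w ∈ V_n` to `v ∈ V_{n+1}`; the entry `f^{(n)}_{v,w}`
of the incidence matrix `F_n`. -/
noncomputable def edgeCount (n : ℕ) (v : B.V (n + 1)) (w : B.V n) : ℕ :=
  Nat.card { e : B.E n // B.rng n e = v ∧ B.src n e = w }

/-- The incidence matrix `F_n`, as a real matrix. -/
noncomputable def incMat (n : ℕ) : Matrix (B.V (n + 1)) (B.V n) ℝ :=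
  fun v w => (B.edgeCount n v w : ℝ)

end BratteliDiagram
namespace BratteliDiagram

variable {B : BratteliDiagram}

/-- An order on a Bratteli diagram: a linear order on each set `r^{-1}(v)`. -/
def OrderOn (B : BratteliDiagram) : Type :=
  ∀ (n : ℕ) (v : B.V (n + 1)), LinearOrder { e : B.E n // B.rng n e = v }

/-- An edge is maximal if it is the largest element of `r^{-1}(r(e))`. -/
def IsMaxEdge (ω : B.OrderOn) {n : ℕ} (e : B.E n) : Prop :=
  ∀ e' : { e' : B.E n // B.rng n e' = B.rng n e }, (ω n (B.rng n e)).le e' ⟨e, rfl⟩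

/-- An edge is minimal if it is the smallest element of `r^{-1}(r(e))`. -/
def IsMinEdge (ω : B.OrderOn) {n : ℕ} (e : B.E n) : Prop :=
  ∀ e' : { e' : B.E n // B.rng n e' = B.rng n e }, (ω n (B.rng n e)).le ⟨e, rfl⟩ e'

/-- A maximal infinite path. -/
def IsMaxPath (ω : B.OrderOn) (x : B.PathSpace) : Prop := ∀ n, IsMaxEdge ω (x.1 n)

/-- A minimal infinite path. -/
def IsMinPath (ω : B.OrderOn) (x : B.PathSpace) : Prop := ∀ n, IsMinEdge ω (x.1 n)

/-- `e'` is the successor of `e` in the linearly ordered set `r^{-1}(r(e))`. -/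
def IsSuccEdge (ω : B.OrderOn) {n : ℕ} (e e' : B.E n) : Prop :=
  ∃ h : B.rng n e' = B.rng n e,
    (ω n (B.rng n e)).lt ⟨e, rfl⟩ ⟨e', h⟩ ∧
      ∀ f : { f : B.E n // B.rng n f = B.rng n e },
        (ω n (B.rng n e)).lt ⟨e, rfl⟩ f → (ω n (B.rng n e)).le ⟨e', h⟩ f

/-- `φ` is a (continuous) Vershik map for the ordered Bratteli diagram `(B, ω)`. -/
def IsVershikMap (ω : B.OrderOn) (φ : B.PathSpace ≃ₜ B.PathSpace) : Prop :=
  ((φ : B.PathSpace → B.PathSpace) '' { x | IsMaxPath ω x } = { x | IsMinPath ω x }) ∧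
    ∀ x : B.PathSpace, ¬IsMaxPath ω x →
      ∃ k : ℕ, (∀ i < k, IsMaxEdge ω (x.1 i)) ∧ ¬IsMaxEdge ω (x.1 k) ∧
        IsSuccEdge ω (x.1 k) ((φ x).1 k) ∧
        (∀ i < k, IsMinEdge ω ((φ x).1 i)) ∧
        ∀ i, k < i → (φ x).1 i = x.1 i

/-- An order is perfect if it admits a Vershik map. -/
def PerfectOrder (ω : B.OrderOn) : Prop := ∃ φ : B.PathSpace ≃ₜ B.PathSpace, IsVershikMap ω φ

end BratteliDiagram

open BratteliDiagram

/-- `(X, T)` is conjugate to the Bratteli–Vershik system of a properly ordered Bratteli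
diagram having at most `K` vertices at every level `n ≥ 1`. -/
def HasBVModelOfRank (X : Type) [TopologicalSpace X] (T : X ≃ₜ X) (K : ℕ) : Prop :=
  ∃ B : BratteliDiagram, (∀ n : ℕ, 1 ≤ n → Nat.card (B.V n) ≤ K) ∧
    ∃ ω : B.OrderOn,
      (∃! x : B.PathSpace, IsMaxPath ω x) ∧ (∃! x : B.PathSpace, IsMinPath ω x) ∧
      ∃ φ : B.PathSpace ≃ₜ B.PathSpace, IsVershikMap ω φ ∧
        ∃ h : X ≃ₜ B.PathSpace, ∀ x : X, h (T x) = φ (h x)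

/-- The word `y` occurs in the bi-infinite sequence `W` at position `i`. -/
def OccursAt {α : Type*} (W : ℤ → α) (i : ℤ) (y : List α) : Prop :=
  ∀ (k : ℕ) (hk : k < y.length), y[k] = W (i + k)

/-- `P` is a set of cut positions of `W` from which one can keep reading words of `Y`
to the right. -/
def RightClosed {α : Type*} (W : ℤ → α) (Y : Finset (List α)) (P : Set ℤ) : Prop :=
  ∀ i ∈ P, ∃ y ∈ Y, OccursAt W i y ∧ i + y.length ∈ P

/-- Two words of `Y` are linked if they start two right-infinite `Y`-factorizations of the
same sequence. -/
def Linked {α : Type*} (Y : Finset (List α)) (a b : List α) : Prop :=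
  a ∈ Y ∧ b ∈ Y ∧ ∃ (W : ℤ → α) (i : ℤ) (P Q : Set ℤ), RightClosed W Y P ∧ RightClosed W Y Q ∧
    OccursAt W i a ∧ OccursAt W i b ∧ i + a.length ∈ P ∧ i + b.length ∈ Q

/-- The word `y` is a concatenation of words of `F`. -/
def SpannedBy {α : Type*} (F : Finset (List α)) (y : List α) : Prop :=
  ∃ L : List (List α), (∀ l ∈ L, l ∈ F) ∧ L.flatten = y

section Words

variable {α : Type*}

theorem occursAt_append {W : ℤ → α} {i : ℤ} {a b : List α} :
    OccursAt W i (a ++ b) ↔ OccursAt W i a ∧ OccursAt W (i + a.length) b := by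
  constructor
  · intro h
    refine ⟨fun k hk => ?_, fun k hk => ?_⟩
    · have := h k (by simp; omega)
      rwa [List.getElem_append_left hk] at this
    · have := h (a.length + k) (by simp; omega)
      rw [List.getElem_append_right (by omega)] at this
      simp only [Nat.add_sub_cancel_left] at this
      rw [this]; congr 1; push_cast; ring
  · rintro ⟨h1, h2⟩ k hk
    by_cases hka : k < a.length
    · rw [List.getElem_append_left hka]; exact h1 k hka
    · rw [List.getElem_append_right (by omega), h2 (k - a.length) (by simp at hk; omega)]
      congr 1; omega

theorem OccursAt.prefix_of_length_le {W : ℤ → α} {i : ℤ} {a b : List α}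
    (ha : OccursAt W i a) (hb : OccursAt W i b) (h : a.length ≤ b.length) : a <+: b := by
  rw [List.prefix_iff_eq_take]
  refine List.ext_getElem (by simp; omega) fun k h1 h2 => ?_
  rw [ha k h1, List.getElem_take, hb k (by omega)]

theorem OccursAt.eq_of_length_eq {W : ℤ → α} {i : ℤ} {a b : List α}
    (ha : OccursAt W i a) (hb : OccursAt W i b) (h : a.length = b.length) : a = b :=
  (ha.prefix_of_length_le hb h.le).eq_of_length h

theorem Linked.symm {Y : Finset (List α)} {a b : List α} (h : Linked Y a b) : Linked Y b a := by
  obtain ⟨ha, hb, W, i, P, Q, hP, hQ, h1, h2, h3, h4⟩ := h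
  exact ⟨hb, ha, W, i, Q, P, hQ, hP, h2, h1, h4, h3⟩

theorem SpannedBy.of_mem {F : Finset (List α)} {y : List α} (h : y ∈ F) : SpannedBy F y :=
  ⟨[y], by simpa using h, by simp⟩

theorem SpannedBy.append {F : Finset (List α)} {y z : List α} (hy : SpannedBy F y)
    (hz : SpannedBy F z) : SpannedBy F (y ++ z) := by
  obtain ⟨L, hL, rfl⟩ := hy
  obtain ⟨M, hM, rfl⟩ := hz
  refine ⟨L ++ M, fun l hl => ?_, by simp⟩
  rcases List.mem_append.1 hl with h | h
  · exact hL l h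
  · exact hM l h

/-- Refining the cut positions when the word `a ++ g` is replaced by the two words `a`, `g`. -/
def refineCuts (W : ℤ → α) (g : List α) (P : Set ℤ) : Set ℤ :=
  {k | k ∈ P ∨ (OccursAt W k g ∧ k + g.length ∈ P)}

theorem RightClosed.refineCuts [DecidableEq α] {W : ℤ → α} {Y : Finset (List α)} {P : Set ℤ}
    (hP : RightClosed W Y P) {a g : List α} (ha : a ∈ Y) (hg : g ≠ []) :
    RightClosed W (insert g (Y.erase (a ++ g))) (refineCuts W g P) := by
  rintro k (hk | ⟨hk, hk'⟩)
  · obtain ⟨y, hy, hoc, hend⟩ := hP k hk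
    by_cases hyb : y = a ++ g
    · subst hyb
      rw [occursAt_append] at hoc
      refine ⟨a, ?_, hoc.1, Or.inr ⟨hoc.2, ?_⟩⟩
      · simp [ha, hg]
      · rw [List.length_append] at hend; push_cast at hend; rwa [add_assoc]
    · exact ⟨y, by simp [hyb, hy], hoc, Or.inl hend⟩
  · exact ⟨g, by simp, hk, Or.inl hk'⟩

theorem exists_reduced_step [DecidableEq α] {W : ℤ → α} {Y : Finset (List α)} {P : Set ℤ}
    {a g c : List α} {i : ℤ} (ha : a ∈ Y) (hg : g ≠ []) (hc : c ∈ Y)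
    (hoc : OccursAt W i c) (hend : i + c.length ∈ P) :
    (if c = a ++ g then a else c) ∈ Y.erase (a ++ g) ∧
      OccursAt W i (if c = a ++ g then a else c) ∧
      i + (if c = a ++ g then a else c).length ∈ refineCuts W g P := by
  split_ifs with h
  · subst h
    rw [occursAt_append] at hoc
    refine ⟨by simp [ha, hg], hoc.1, Or.inr ⟨hoc.2, ?_⟩⟩
    rw [List.length_append] at hend; push_cast at hend; rwa [add_assoc]
  · exact ⟨by simp [h, hc], hoc, Or.inl hend⟩

/-- The graph lemma: if `Y` has `c` classes under the equivalence relation generated by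
`Linked`, then `Y` is spanned by at most `c` words. -/
theorem exists_spanning_card_le [DecidableEq α] (good : List α → Prop)
    (hgood : ∀ a g, a ≠ [] → good a → good (a ++ g) → good g) (n : ℕ) :
    ∀ Y : Finset (List α), ∑ y ∈ Y, y.length = n → (∀ y ∈ Y, y ≠ [] ∧ good y) →
      ∀ q : List α → List α,
        (∀ a ∈ Y, ∀ b ∈ Y, q a = q b → Relation.EqvGen (Linked Y) a b) →
        ∃ F : Finset (List α), F.card ≤ (Y.image q).card ∧ (∀ f ∈ F, f ≠ [] ∧ good f) ∧
          ∀ y ∈ Y, SpannedBy F y := by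
  induction n using Nat.strong_induction_on with
  | _ n ih =>
  intro Y hn hY q hq
  by_cases hlink : ∃ a b, a ≠ b ∧ Linked Y a b
  swap
  · push Not at hlink
    refine ⟨Y, ?_, hY, fun y hy => SpannedBy.of_mem hy⟩
    rw [Finset.card_image_of_injOn]
    intro a ha b hb hab
    have := hq a ha b hb hab
    have key : ∀ x y, Relation.EqvGen (Linked Y) x y → x = y := by
      intro x y h
      induction h with
      | rel x y h => by_contra hne; exact hlink x y hne h
      | refl x => rfl
      | symm x y _ h => exact h.symm
      | trans x y z _ _ h1 h2 => exact h1.trans h2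
    exact key a b this
  obtain ⟨a, b, hab, hl, hle⟩ : ∃ a b, a ≠ b ∧ Linked Y a b ∧ a.length ≤ b.length := by
    obtain ⟨a, b, hab, hl⟩ := hlink
    rcases le_total a.length b.length with h | h
    · exact ⟨a, b, hab, hl, h⟩
    · exact ⟨b, a, hab.symm, hl.symm, h⟩
  obtain ⟨ha, hb, W, i, P, Q, hP, hQ, hoa, hob, hea, heb⟩ := hl
  obtain ⟨g, rfl⟩ := hoa.prefix_of_length_le hob hle
  have hg : g ≠ [] := by rintro rfl; simp at hab
  set Y' := insert g (Y.erase (a ++ g)) with hY'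
  set ρ : List α → List α := fun c => if c = a ++ g then a else c with hρ
  have hρmem : ∀ c ∈ Y, ρ c ∈ Y.erase (a ++ g) := by
    intro c hc
    simp only [hρ]
    split_ifs with h
    · simp [ha, hg]
    · simp [h, hc]
  have hρid : ∀ c ∈ Y.erase (a ++ g), ρ c = c := by
    intro c hc
    simp only [hρ]
    rw [if_neg (Finset.ne_of_mem_erase hc)]
  have hmap : ∀ c d, Linked Y c d → Linked Y' (ρ c) (ρ d) := by
    rintro c d ⟨hc, hd, W, i, P, Q, hP, hQ, hoc, hod, hec, hed⟩
    obtain ⟨h1, h2, h3⟩ := exists_reduced_step ha hg hc hoc hec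
    obtain ⟨h1', h2', h3'⟩ := exists_reduced_step ha hg hd hod hed
    exact ⟨Finset.mem_insert_of_mem h1, Finset.mem_insert_of_mem h1', W, i, _, _,
      hP.refineCuts ha hg, hQ.refineCuts ha hg, h2, h2', h3, h3'⟩
  have hmap' : ∀ c d, Relation.EqvGen (Linked Y) c d →
      Relation.EqvGen (Linked Y') (ρ c) (ρ d) := by
    intro c d h
    induction h with
    | rel x y h => exact .rel _ _ (hmap x y h)
    | refl x => exact .refl _
    | symm x y _ h => exact .symm _ _ h
    | trans x y z _ _ h1 h2 => exact .trans _ _ _ h1 h2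
  obtain ⟨e, he, hel⟩ : ∃ e ∈ Y.erase (a ++ g), Linked Y' e g := by
    obtain ⟨y, hy, hoy, hey⟩ := hP _ hea
    obtain ⟨h1, h2, h3⟩ := exists_reduced_step ha hg hy hoy hey
    refine ⟨_, h1, Finset.mem_insert_of_mem h1, Finset.mem_insert_self _ _, W, _, _, _,
      hP.refineCuts ha hg, hQ.refineCuts ha hg, h2, (occursAt_append.1 hob).2, h3, Or.inl ?_⟩
    rw [List.length_append] at heb; push_cast at heb; rwa [add_assoc]
  have hlt : ∑ y ∈ Y', y.length < n := by
    have h1 : ∑ y ∈ Y', y.length ≤ g.length + ∑ y ∈ Y.erase (a ++ g), y.length := by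
      by_cases hgm : g ∈ Y.erase (a ++ g)
      · rw [hY', Finset.insert_eq_of_mem hgm]; omega
      · rw [hY', Finset.sum_insert hgm]
    have h2 := Finset.add_sum_erase Y List.length hb
    rw [List.length_append] at h2
    have h3 : 0 < a.length := List.length_pos_iff.2 (hY a ha).1
    omega
  have hgoodY' : ∀ y ∈ Y', y ≠ [] ∧ good y := by
    intro y hy
    rcases Finset.mem_insert.1 hy with rfl | hy
    · exact ⟨hg, hgood a y (hY a ha).1 (hY a ha).2 (hY _ hb).2⟩
    · exact hY y (Finset.mem_of_mem_erase hy)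
  have hfib : ∀ c ∈ Y.erase (a ++ g), ∀ d ∈ Y.erase (a ++ g), q c = q d →
      Relation.EqvGen (Linked Y') c d := by
    intro c hc d hd hcd
    have := hmap' c d (hq c (Finset.mem_of_mem_erase hc) d (Finset.mem_of_mem_erase hd) hcd)
    rwa [hρid c hc, hρid d hd] at this
  obtain ⟨q', hq', himg⟩ : ∃ q' : List α → List α,
      (∀ c ∈ Y', ∀ d ∈ Y', q' c = q' d → Relation.EqvGen (Linked Y') c d) ∧
        Y'.image q' ⊆ Y.image q := by
    by_cases hgm : g ∈ Y.erase (a ++ g)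
    · refine ⟨q, ?_, ?_⟩
      · rw [hY', Finset.insert_eq_of_mem hgm]
        rw [hY', Finset.insert_eq_of_mem hgm] at hfib
        exact hfib
      · rw [hY', Finset.insert_eq_of_mem hgm]
        exact Finset.image_subset_image (Finset.erase_subset _ _)
    · have hne : ∀ c ∈ Y.erase (a ++ g), c ≠ g := fun c hc h => hgm (h ▸ hc)
      have hge : Relation.EqvGen (Linked Y') e g := .rel _ _ hel
      refine ⟨Function.update q g (q e), ?_, ?_⟩
      · intro c hc d hd hcd
        rcases Finset.mem_insert.1 hc with rfl | hc <;> rcases Finset.mem_insert.1 hd with rfl | hd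
        · exact .refl _
        · rw [Function.update_self, Function.update_of_ne (hne d hd)] at hcd
          exact .trans _ _ _ (.symm _ _ hge) (hfib e he d hd hcd)
        · rw [Function.update_self, Function.update_of_ne (hne c hc)] at hcd
          exact .trans _ _ _ (hfib c hc e he hcd) hge
        · rw [Function.update_of_ne (hne c hc), Function.update_of_ne (hne d hd)] at hcd
          exact hfib c hc d hd hcd
      · intro z hz
        obtain ⟨c, hc, rfl⟩ := Finset.mem_image.1 hz
        rcases Finset.mem_insert.1 hc with rfl | hc
        · rw [Function.update_self]
          exact Finset.mem_image_of_mem _ (Finset.mem_of_mem_erase he)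
        · rw [Function.update_of_ne (hne c hc)]
          exact Finset.mem_image_of_mem _ (Finset.mem_of_mem_erase hc)
  obtain ⟨F, hF, hFg, hspan⟩ := ih _ hlt Y' rfl hgoodY' q' hq'
  refine ⟨F, hF.trans (Finset.card_le_card himg), hFg, fun y hy => ?_⟩
  by_cases hyb : y = a ++ g
  · subst hyb
    exact (hspan a (by simp [hY', ha, hg])).append (hspan g (by simp [hY']))
  · exact hspan y (by simp [hY', hyb, hy])

end Words

/-- `P` is the set of cuts of a factorization of the bi-infinite sequence `W` into words of `X`;
the word read at the cut `i` is `w i`. -/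
structure IsFactorization {α : Type*} (W : ℤ → α) (X : Finset (List α)) (P : Set ℤ)
    (w : ℤ → List α) : Prop where
  mem : ∀ i ∈ P, w i ∈ X
  occ : ∀ i ∈ P, OccursAt W i (w i)
  next : ∀ i ∈ P, i + (w i).length ∈ P
  gap : ∀ i ∈ P, ∀ k, i < k → k < i + (w i).length → k ∉ P
  cover : ∀ k, ∃ i ∈ P, i ≤ k ∧ k < i + (w i).length

/-- `X` is not spanned by fewer than `card X` good words. -/
def Elementary {α : Type*} (good : List α → Prop) (X : Finset (List α)) : Prop :=
  ∀ F : Finset (List α), (∀ f ∈ F, f ≠ [] ∧ good f) → (∀ y ∈ X, SpannedBy F y) →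
    X.card ≤ F.card

/-- The cuts `t` and `t + N` of the factorization `P` fall at the same place inside two occurrences
of the same word of the factorization `P'`. -/
def Overlap {α : Type*} (P P' : Set ℤ) (w' : ℤ → List α) (N t : ℤ) : Prop :=
  ∃ j, t ∈ P ∧ t + N ∈ P ∧ j ∈ P' ∧ j + N ∈ P' ∧ j < t ∧ t < j + (w' j).length ∧ w' (j + N) = w' j

section Defect

variable {α : Type*} {good : List α → Prop} {W : ℤ → α} {X : Finset (List α)} {P P' : Set ℤ}
  {w w' : ℤ → List α}

theorem RightClosed.mono {Y : Finset (List α)} (h : RightClosed W X P) (hXY : X ⊆ Y) :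
    RightClosed W Y P := fun i hi =>
  let ⟨y, hy, h⟩ := h i hi
  ⟨y, hXY hy, h⟩

theorem IsFactorization.rightClosed (h : IsFactorization W X P w) : RightClosed W X P :=
  fun i hi => ⟨w i, h.mem i hi, h.occ i hi, h.next i hi⟩

theorem IsFactorization.length_pos (h : IsFactorization W X P w) (hX : [] ∉ X) {i : ℤ}
    (hi : i ∈ P) : 0 < (w i).length :=
  List.length_pos_iff.2 fun h0 => hX (h0 ▸ h.mem i hi)

/-- An elementary set of words with one word `s` added admits at most one word linked to `s`. -/
theorem Elementary.eq_of_linked [DecidableEq α]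
    (hgood : ∀ a g, a ≠ [] → good a → good (a ++ g) → good g) (hX : Elementary good X)
    (hXg : ∀ y ∈ X, y ≠ [] ∧ good y) {s y z : List α} (hs : s ≠ [] ∧ good s)
    (hy : y ∈ X) (hz : z ∈ X) (hsy : Linked (insert s X) s y) (hsz : Linked (insert s X) s z) :
    y = z := by
  by_contra hyz
  have hYg : ∀ a ∈ insert s X, a ≠ [] ∧ good a := by
    intro a ha
    rcases Finset.mem_insert.1 ha with rfl | ha
    · exact hs
    · exact hXg a ha
  obtain ⟨F, hF, hFg, hspan⟩ := exists_spanning_card_le good hgood _ (insert s X) rfl hYg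
    (fun c => if c = y ∨ c = z then s else c) (by
      have key : ∀ a, Relation.EqvGen (Linked (insert s X)) a (if a = y ∨ a = z then s else a) := by
        intro a
        split_ifs with h
        · rcases h with rfl | rfl
          · exact .rel _ _ hsy.symm
          · exact .rel _ _ hsz.symm
        · exact .refl _
      intro a _ b _ hab
      have h1 := key a
      rw [show (if a = y ∨ a = z then s else a) = if b = y ∨ b = z then s else b from hab] at h1
      exact .trans _ _ _ h1 (.symm _ _ (key b)))
  have h1 := hX F hFg fun y hy => hspan y (Finset.mem_insert_of_mem hy)
  have h2 : (insert s X).image (fun c => if c = y ∨ c = z then s else c) ⊆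
      insert s ((X.erase y).erase z) := by
    intro c hc
    obtain ⟨d, hd, rfl⟩ := Finset.mem_image.1 hc
    split_ifs with h
    · simp
    · push Not at h
      rcases Finset.mem_insert.1 hd with rfl | hd
      · simp
      · simp [h.1, h.2, hd]
  have h3 := Finset.card_le_card h2
  have h4 := Finset.card_insert_le s ((X.erase y).erase z)
  have h5 : ((X.erase y).erase z).card < (X.erase y).card :=
    Finset.card_erase_lt_of_mem (by simp [hz, Ne.symm hyz])
  have h6 : (X.erase y).card < X.card := Finset.card_erase_lt_of_mem hy
  omega

theorem Overlap.step [DecidableEq α]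
    (hgood : ∀ a g, a ≠ [] → good a → good (a ++ g) → good g) (hX : Elementary good X)
    (hXg : ∀ y ∈ X, y ≠ [] ∧ good y) (hP : IsFactorization W X P w)
    (hP' : IsFactorization W X P' w')
    (hcut : ∀ i y, y ≠ [] → OccursAt W i y → i ∈ P ∪ P' → i + y.length ∈ P ∪ P' → good y)
    {N t : ℤ} (h : Overlap P P' w' N t) :
    ∃ t', t < t' ∧ (∀ i, t ≤ i → i < t' → W (i + N) = W i) ∧
      (∀ c ∈ P ∩ P', t + N < c → t' + N ≤ c) ∧
      (Overlap P P' w' N t' ∨ Overlap P' P w N t' ∨ (t' ∈ P ∩ P' ∧ t' + N ∈ P ∩ P')) := by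
  obtain ⟨j, ht, htN, hj, hjN, hjt, htj, hw'⟩ := h
  obtain ⟨p, s, hps, hp⟩ : ∃ p s, w' j = p ++ s ∧ (p.length : ℤ) = t - j := by
    refine ⟨(w' j).take (t - j).toNat, (w' j).drop (t - j).toNat, by simp, ?_⟩
    rw [List.length_take]; omega
  have hlen : ((w' j).length : ℤ) = t - j + s.length := by rw [hps, List.length_append]; omega
  have hs : s ≠ [] := by rintro rfl; simp at hlen; omega
  have hocc : OccursAt W t s := by
    have := hP'.occ j hj
    rw [hps, occursAt_append, hp] at this
    simpa using this.2
  have hoccN : OccursAt W (t + N) s := by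
    have := hP'.occ (j + N) hjN
    rw [hw', hps, occursAt_append, hp] at this
    have h2 := this.2
    rwa [show j + N + (t - j) = t + N by ring] at h2
  have hend : t + s.length ∈ P' := by
    have := hP'.next j hj
    rwa [hlen, show j + (t - j + s.length) = t + (s.length : ℤ) by ring] at this
  have hendN : t + N + s.length ∈ P' := by
    have := hP'.next (j + N) hjN
    rwa [hw', hlen, show j + N + (t - j + s.length) = t + N + (s.length : ℤ) by ring] at this
  have hsg : good s := hcut t s hs hocc (Or.inl ht) (Or.inr hend)
  have hR := hP.rightClosed.mono (Finset.subset_insert s X)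
  have hR' := hP'.rightClosed.mono (Finset.subset_insert s X)
  have heq : w t = w (t + N) :=
    hX.eq_of_linked hgood hXg ⟨hs, hsg⟩ (hP.mem t ht) (hP.mem _ htN)
      ⟨by simp, by simp [hP.mem t ht], W, t, P', P, hR', hR, hocc, hP.occ t ht, hend,
        hP.next t ht⟩
      ⟨by simp, by simp [hP.mem _ htN], W, t + N, P', P, hR', hR, hoccN, hP.occ _ htN, hendN,
        hP.next _ htN⟩
  have hpos : 0 < (w t).length := List.length_pos_iff.2 (hXg _ (hP.mem t ht)).1
  have hper : ∀ i, t ≤ i → i < t + (w t).length → W (i + N) = W i := by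
    intro i h1 h2
    have e1 := hP.occ t ht (i - t).toNat (by omega)
    have e2 := hP.occ (t + N) htN (i - t).toNat (by rw [← heq]; omega)
    simp only [← heq] at e2
    rw [e1] at e2
    rw [show t + ((i - t).toNat : ℤ) = i by omega,
      show t + N + ((i - t).toNat : ℤ) = i + N by omega] at e2
    exact e2.symm
  have hfst : ∀ c ∈ P ∩ P', t + N < c → t + (w t).length + N ≤ c := by
    intro c hc hlt
    by_contra hcon
    exact hP.gap (t + N) htN c hlt (by rw [← heq]; omega) hc.1
  have hnextN : t + (w t).length + N ∈ P := by
    have := hP.next _ htN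
    rw [← heq] at this
    convert this using 1; ring
  have hnextN' : j + (w' j).length + N ∈ P' := by
    have := hP'.next _ hjN
    rw [hw'] at this
    convert this using 1; ring
  rcases lt_trichotomy (t + ((w t).length : ℤ)) (j + (w' j).length) with hlt | he | hgt
  · exact ⟨t + (w t).length, by omega, hper, hfst, Or.inl
      ⟨j, hP.next t ht, hnextN, hj, hjN, by omega, hlt, hw'⟩⟩
  · refine ⟨t + (w t).length, by omega, hper, hfst, Or.inr (Or.inr
      ⟨⟨hP.next t ht, ?_⟩, hnextN, ?_⟩)⟩
    · rw [he]; exact hP'.next j hj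
    · rw [he]; exact hnextN'
  · refine ⟨j + (w' j).length, htj, fun i h1 h2 => hper i h1 (by omega), fun c hc hlt => ?_,
      Or.inr (Or.inl ⟨t, hP'.next j hj, hnextN', ht, htN, htj, hgt, heq.symm⟩)⟩
    have := hfst c hc hlt
    omega

/-- Two factorizations over an elementary set of words agree to the right of a common cut. -/
theorem Elementary.mem_iff_of_common_cut_le [DecidableEq α]
    (hgood : ∀ a g, a ≠ [] → good a → good (a ++ g) → good g) (hX : Elementary good X)
    (hXg : ∀ y ∈ X, y ≠ [] ∧ good y) (hP : IsFactorization W X P w)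
    (hP' : IsFactorization W X P' w') :
    ∀ c ∈ P ∩ P', ∀ k, c ≤ k → (k ∈ P ↔ k ∈ P') := by
  have hX0 : [] ∉ X := fun h => (hXg _ h).1 rfl
  have hstep : ∀ c ∈ P ∩ P', w c = w' c := fun c hc =>
    hX.eq_of_linked hgood hXg (hXg _ (hP.mem c hc.1)) (hP.mem c hc.1) (hP'.mem c hc.2)
      ⟨by simp, by simp [hP.mem c hc.1], W, c, P, P, hP.rightClosed.mono (Finset.subset_insert _ _),
        hP.rightClosed.mono (Finset.subset_insert _ _), hP.occ c hc.1, hP.occ c hc.1,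
        hP.next c hc.1, hP.next c hc.1⟩
      ⟨by simp, by simp [hP'.mem c hc.2], W, c, P, P',
        hP.rightClosed.mono (Finset.subset_insert _ _),
        hP'.rightClosed.mono (Finset.subset_insert _ _), hP.occ c hc.1, hP'.occ c hc.2,
        hP.next c hc.1, hP'.next c hc.2⟩
  have hind : ∀ n : ℕ, ∀ c ∈ P ∩ P', ∀ k, c ≤ k → k ≤ c + n → (k ∈ P ↔ k ∈ P') := by
    intro n
    induction n with
    | zero =>
      intro c hc k h1 h2
      obtain rfl : k = c := by push_cast at h2; omega
      exact iff_of_true hc.1 hc.2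
    | succ n ih =>
      intro c hc k h1 h2
      have hpos := hP.length_pos hX0 hc.1
      have hn : c + ((w c).length : ℤ) ∈ P ∩ P' :=
        ⟨hP.next c hc.1, by rw [hstep c hc]; exact hP'.next c hc.2⟩
      rcases eq_or_lt_of_le h1 with rfl | h1
      · exact iff_of_true hc.1 hc.2
      · by_cases hk : k < c + (w c).length
        · exact iff_of_false (hP.gap c hc.1 k h1 hk)
            (hP'.gap c hc.2 k h1 (by rw [← hstep c hc]; exact hk))
        · exact ih _ hn k (by omega) (by push_cast at h2; omega)
  intro c hc k hk
  exact hind (k - c).toNat c hc k hk (by omega)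

/-- An elementary set of words gives at most one factorization of a nonperiodic bi-infinite
sequence. -/
theorem Elementary.cuts_eq [DecidableEq α]
    (hgood : ∀ a g, a ≠ [] → good a → good (a ++ g) → good g) (hX : Elementary good X)
    (hXg : ∀ y ∈ X, y ≠ [] ∧ good y) (hP : IsFactorization W X P w)
    (hP' : IsFactorization W X P' w')
    (hcut : ∀ i y, y ≠ [] → OccursAt W i y → i ∈ P ∪ P' → i + y.length ∈ P ∪ P' → good y)
    (hW : ∀ N : ℤ, 0 < N → ∃ i, W (i + N) ≠ W i) : P = P' := by
  by_contra hne
  have hright := hX.mem_iff_of_common_cut_le hgood hXg hP hP'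
  obtain ⟨u, hu⟩ : ∃ u, ∀ c ∈ P ∩ P', u ≤ c := by
    by_contra hcon
    push Not at hcon
    refine hne (Set.ext fun k => ?_)
    obtain ⟨c, hc, hck⟩ := hcon k
    exact hright c hc k hck.le
  choose J hJ hJle hJlt using hP'.cover
  have hstep : ∀ N t, (Overlap P P' w' N t ∨ Overlap P' P w N t) →
      ∃ t', t < t' ∧ (∀ i, t ≤ i → i < t' → W (i + N) = W i) ∧
      (∀ c ∈ P ∩ P', t + N < c → t' + N ≤ c) ∧
      ((Overlap P P' w' N t' ∨ Overlap P' P w N t') ∨ (t' ∈ P ∩ P' ∧ t' + N ∈ P ∩ P')) := by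
    rintro N t (h | h)
    · obtain ⟨t', h1, h2, h3, h4⟩ := h.step hgood hX hXg hP hP' hcut
      exact ⟨t', h1, h2, h3, by tauto⟩
    · obtain ⟨t', h1, h2, h3, h4⟩ := h.step hgood hX hXg hP' hP
        (by rw [Set.union_comm]; exact hcut)
      rw [Set.inter_comm] at h3 h4
      exact ⟨t', h1, h2, h3, by tauto⟩
  set S : Set ℤ := {t | t ∈ P ∧ t < u} with hS
  have hSinf : S.Infinite := by
    refine Set.infinite_of_not_bddBelow ?_
    rintro ⟨m, hm⟩
    obtain ⟨i, hi, hik, -⟩ := hP.cover (min (m - 1) (u - 1))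
    have := hm (show i ∈ S from ⟨hi, by omega⟩)
    omega
  obtain ⟨T, hTS, hTinf, hTst⟩ : ∃ T ⊆ S, T.Infinite ∧
      ∀ t ∈ T, ∀ t' ∈ T, w' (J t) = w' (J t') ∧ t - J t = t' - J t' := by
    by_contra hcon
    push Not at hcon
    refine hSinf (Set.Finite.of_finite_fibers (fun t => (w' (J t), t - J t)) ?_ ?_)
    · refine ((X ×ˢ Finset.Ico (0 : ℤ) (∑ y ∈ X, y.length : ℕ)).finite_toSet).subset ?_
      rintro _ ⟨t, ht, rfl⟩
      have h1 := hP'.mem _ (hJ t)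
      have h2 :=
        Finset.single_le_sum (f := fun y : List α => y.length) (fun _ _ => Nat.zero_le _) h1
      simp only [Finset.coe_product, Finset.coe_Ico, Set.mem_prod, Finset.mem_coe, Set.mem_Ico]
      have h3 := hJle t
      have h4 := hJlt t
      exact ⟨h1, by omega, by omega⟩
    · intro z _
      by_contra hfin
      obtain ⟨t, ht, t', ht', h⟩ := hcon _ Set.inter_subset_left hfin
      have e := ht.2.trans ht'.2.symm
      simp only [Prod.mk.injEq] at e
      exact h e.1 e.2
  have hTov : ∀ t ∈ T, ∀ t' ∈ T, Overlap P P' w' (t' - t) t := by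
    intro t ht t' ht'
    obtain ⟨h1, h2⟩ := hTst t ht t' ht'
    have htP := (hTS ht).1
    have hJt : J t + (t' - t) = J t' := by omega
    refine ⟨J t, htP, ?_, hJ t, ?_, lt_of_le_of_ne (hJle t) ?_, hJlt t, ?_⟩
    · rw [add_sub_cancel]; exact (hTS ht').1
    · rw [hJt]; exact hJ t'
    · intro h
      have := hu t ⟨htP, h ▸ hJ t⟩
      have := (hTS ht).2
      omega
    · rw [hJt, h1]
  obtain ⟨t₁, ht₁, t₂, ht₂, hlt⟩ : ∃ t₁ ∈ T, ∃ t₂ ∈ T, t₁ < t₂ := by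
    obtain ⟨a, ha, b, hb, hab⟩ := hTinf.nontrivial
    rcases lt_or_gt_of_ne hab with h | h
    · exact ⟨a, ha, b, hb, h⟩
    · exact ⟨b, hb, a, ha, h⟩
  by_cases hC : ∃ c, c ∈ P ∩ P'
  · obtain ⟨c, hc, hcmin⟩ := Int.exists_least_of_bdd (P := fun c => c ∈ P ∩ P') ⟨u, hu⟩ hC
    have key : ∀ n : ℕ, ∀ N t, 0 < N → (Overlap P P' w' N t ∨ Overlap P' P w N t) → t + N < c →
        c - N - t ≤ n → False := by
      intro n
      induction n with
      | zero => intro N t _ _ h1 h2; push_cast at h2; omega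
      | succ n ih =>
        intro N t hN ho h1 h2
        obtain ⟨t', h3, -, h4, h5⟩ := hstep N t ho
        have h6 := h4 c hc h1
        rcases h5 with h5 | h5
        · refine ih N t' hN h5 (lt_of_le_of_ne h6 ?_) (by push_cast at h2; omega)
          rintro rfl
          rcases h5 with ⟨j, -, -, -, g1, g2, g3, g4⟩ | ⟨j, -, -, -, g1, g2, g3, g4⟩
          · exact hP'.gap (j + N) g1 (t' + N) (by omega) (by rw [g4]; omega) hc.2
          · exact hP.gap (j + N) g1 (t' + N) (by omega) (by rw [g4]; omega) hc.1
        · have := hcmin t' h5.1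
          omega
    have h1 := hu c hc
    have h2 := (hTS ht₂).2
    exact key (c - (t₂ - t₁) - t₁).toNat (t₂ - t₁) t₁ (by omega) (Or.inl (hTov t₁ ht₁ t₂ ht₂))
      (by omega) (by omega)
  · have hfar : ∀ n : ℕ, ∀ N t, (Overlap P P' w' N t ∨ Overlap P' P w N t) →
        ∀ i, t ≤ i → i < t + n → W (i + N) = W i := by
      intro n
      induction n with
      | zero => intro N t _ i h1 h2; push_cast at h2; omega
      | succ n ih =>
        intro N t ho i h1 h2
        obtain ⟨t', h3, h4, -, h5⟩ := hstep N t ho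
        rcases lt_or_ge i t' with h6 | h6
        · exact h4 i h1 h6
        · refine ih N t' (h5.resolve_right fun h => hC ⟨t', h.1⟩) i h6 ?_
          push_cast at h2; omega
    have hper : ∀ t ∈ T, ∀ t' ∈ T, ∀ i, t ≤ i → W (i + (t' - t)) = W i := fun t ht t' ht' i hi =>
      hfar (i - t + 1).toNat _ t (Or.inl (hTov t ht t' ht')) i hi (by omega)
    obtain ⟨k, hk⟩ := hW (t₂ - t₁) (by omega)
    obtain ⟨t₀, ht₀, hle⟩ : ∃ t₀ ∈ T, t₀ ≤ min k t₁ := by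
      by_contra hcon
      push Not at hcon
      refine hTinf ((Set.finite_Icc (min k t₁) u).subset fun t ht => ⟨(hcon t ht).le, ?_⟩)
      exact (hTS ht).2.le
    have e1 := hper t₀ ht₀ t₁ ht₁ k (by omega)
    have e2 := hper t₁ ht₁ t₂ ht₂ (k + (t₁ - t₀)) (by omega)
    have e3 := hper t₀ ht₀ t₁ ht₁ (k + (t₂ - t₁)) (by omega)
    apply hk
    rw [← e3, ← e1, ← e2]
    congr 1; ring

end Defect

/-- A Kakutani–Rokhlin partition of `(X, T)` into clopen towers indexed by `V`: the point `x` lies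
in the tower `vtx x`, at level `lvl x`. -/
structure TowerPartition (X : Type) [TopologicalSpace X] (T : X ≃ₜ X) (V : Type) where
  vtx : X → V
  lvl : X → ℕ
  ht : V → ℕ
  isLocallyConstant : IsLocallyConstant fun x => (vtx x, lvl x)
  lvl_lt : ∀ x, lvl x < ht (vtx x)
  vtx_succ : ∀ x, lvl x + 1 < ht (vtx x) → vtx (T x) = vtx x
  lvl_succ : ∀ x, lvl x + 1 < ht (vtx x) → lvl (T x) = lvl x + 1
  lvl_top : ∀ x, lvl x + 1 = ht (vtx x) → lvl (T x) = 0

/-- There are tower partitions with at most `K` towers, with arbitrarily fine levels, and whose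
base is an arbitrarily small neighbourhood of `x₀`. -/
def HasFineTowers (X : Type) [MetricSpace X] (T : X ≃ₜ X) (x₀ : X) (K : ℕ) : Prop :=
  ∀ ε > 0, ∃ (V : Type) (_ : Finite V) (S : TowerPartition X T V), Nat.card V ≤ K ∧
    S.lvl x₀ = 0 ∧ (∀ x, S.lvl x = 0 → dist x x₀ < ε) ∧
    ∀ x y, S.vtx x = S.vtx y → S.lvl x = S.lvl y → dist x y < ε

theorem homeomorph_zpow_add_one {X : Type} [TopologicalSpace X] (T : X ≃ₜ X) (k : ℤ) (x : X) :
    (T.toEquiv ^ (k + 1)) x = T ((T.toEquiv ^ k) x) := by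
  rw [add_comm, zpow_add, zpow_one]; rfl

theorem homeomorph_zpow_add {X : Type} [TopologicalSpace X] (T : X ≃ₜ X) (k l : ℤ) (x : X) :
    (T.toEquiv ^ (k + l)) x = (T.toEquiv ^ k) ((T.toEquiv ^ l) x) := by
  rw [zpow_add]; rfl

theorem homeomorph_continuous_zpow {X : Type} [TopologicalSpace X] (T : X ≃ₜ X) (k : ℤ) :
    Continuous (T.toEquiv ^ k : Equiv.Perm X) := by
  have hnat : ∀ n : ℕ, Continuous (T.toEquiv ^ (n : ℤ) : Equiv.Perm X) ∧
      Continuous (T.toEquiv ^ (-n : ℤ) : Equiv.Perm X) := by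
    intro n
    induction n with
    | zero => simpa using continuous_id
    | succ n ih =>
      constructor
      · have : ((T.toEquiv ^ ((n + 1 : ℕ) : ℤ) : Equiv.Perm X) : X → X) =
            fun x => T ((T.toEquiv ^ (n : ℤ)) x) := by
          funext x; rw [Nat.cast_succ, homeomorph_zpow_add_one]
        rw [this]
        exact T.continuous.comp ih.1
      · have : ((T.toEquiv ^ (-((n + 1 : ℕ) : ℤ)) : Equiv.Perm X) : X → X) =
            fun x => T.symm ((T.toEquiv ^ (-n : ℤ)) x) := by
          funext x
          rw [Homeomorph.eq_symm_apply, ← homeomorph_zpow_add_one]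
          congr 2; push_cast; ring
        rw [this]
        exact T.symm.continuous.comp ih.2
  obtain ⟨n, rfl | rfl⟩ := k.eq_nat_or_neg
  · exact (hnat n).1
  · exact (hnat n).2

namespace TowerPartition

variable {X : Type} [TopologicalSpace X] {T : X ≃ₜ X} {V V' : Type}

/-- The level of the partition containing `x`. -/
def atom (S : TowerPartition X T V) (x : X) : V × ℕ := (S.vtx x, S.lvl x)

theorem lvl_add_one_of_ne (S : TowerPartition X T V) {x : X} (h : S.lvl (T x) ≠ 0) :
    S.lvl x + 1 < S.ht (S.vtx x) :=
  lt_of_le_of_ne (S.lvl_lt x) fun h' => h (S.lvl_top x h')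

theorem up (S : TowerPartition X T V) (x : X) (i : ℕ) (h : S.lvl x + i < S.ht (S.vtx x)) :
    S.vtx ((T.toEquiv ^ (i : ℤ)) x) = S.vtx x ∧
      S.lvl ((T.toEquiv ^ (i : ℤ)) x) = S.lvl x + i := by
  induction i with
  | zero => simp
  | succ i ih =>
    obtain ⟨h1, h2⟩ := ih (by omega)
    rw [Nat.cast_succ, homeomorph_zpow_add_one]
    have h3 : S.lvl ((T.toEquiv ^ (i : ℤ)) x) + 1 < S.ht (S.vtx ((T.toEquiv ^ (i : ℤ)) x)) := by
      rw [h1, h2]; omega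
    rw [S.vtx_succ _ h3, S.lvl_succ _ h3, h1, h2]
    exact ⟨rfl, by omega⟩

theorem down (S : TowerPartition X T V) (x : X) (i : ℕ) (h : i ≤ S.lvl x) :
    S.vtx ((T.toEquiv ^ (-(i : ℤ))) x) = S.vtx x ∧
      S.lvl ((T.toEquiv ^ (-(i : ℤ))) x) + i = S.lvl x := by
  induction i with
  | zero => simp
  | succ i ih =>
    obtain ⟨h1, h2⟩ := ih (by omega)
    set y := (T.toEquiv ^ (-((i + 1 : ℕ) : ℤ))) x with hy
    have hTy : T y = (T.toEquiv ^ (-(i : ℤ))) x := by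
      rw [hy, ← homeomorph_zpow_add_one]; congr 2; push_cast; ring
    rw [← hTy] at h1 h2
    have h3 := S.lvl_add_one_of_ne (x := y) (by omega)
    rw [S.vtx_succ _ h3] at h1
    rw [S.lvl_succ _ h3] at h2
    exact ⟨h1, by omega⟩

theorem shift (S : TowerPartition X T V) (x : X) (i : ℕ) (h : i < S.ht (S.vtx x)) :
    S.vtx ((T.toEquiv ^ ((i : ℤ) - S.lvl x)) x) = S.vtx x ∧
      S.lvl ((T.toEquiv ^ ((i : ℤ) - S.lvl x)) x) = i := by
  obtain ⟨h1, h2⟩ := S.down x (S.lvl x) le_rfl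
  have h3 := S.up ((T.toEquiv ^ (-(S.lvl x : ℤ))) x) i (by rw [h1]; omega)
  rw [← homeomorph_zpow_add, ← sub_eq_add_neg, h1] at h3
  exact ⟨h3.1, by omega⟩

theorem lvl_zpow_ht (S : TowerPartition X T V) (x : X) (h : S.lvl x = 0) :
    S.lvl ((T.toEquiv ^ (S.ht (S.vtx x) : ℤ)) x) = 0 := by
  have h0 := S.lvl_lt x
  obtain ⟨h1, h2⟩ := S.up x (S.ht (S.vtx x) - 1) (by omega)
  have h3 := S.lvl_top _ (show S.lvl ((T.toEquiv ^ ((S.ht (S.vtx x) - 1 : ℕ) : ℤ)) x) + 1 = _ by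
    rw [h1, h2]; omega)
  rw [← homeomorph_zpow_add_one] at h3
  rwa [show ((S.ht (S.vtx x) - 1 : ℕ) : ℤ) + 1 = S.ht (S.vtx x) by omega] at h3

theorem lvl_zpow_ht_sub_lvl (S : TowerPartition X T V) (x : X) :
    S.lvl ((T.toEquiv ^ ((S.ht (S.vtx x) - S.lvl x : ℕ) : ℤ)) x) = 0 := by
  obtain ⟨h1, h2⟩ := S.down x (S.lvl x) le_rfl
  have h3 := S.lvl_zpow_ht _ (show S.lvl ((T.toEquiv ^ (-(S.lvl x : ℤ))) x) = 0 by omega)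
  rw [← homeomorph_zpow_add, h1] at h3
  rwa [Nat.cast_sub (S.lvl_lt x).le]

/-- The itinerary of `x` through the levels of the partition. -/
def name (S : TowerPartition X T V) (x : X) (k : ℤ) : V × ℕ := S.atom ((T.toEquiv ^ k) x)

theorem name_zpow (S : TowerPartition X T V) (x : X) (k l : ℤ) :
    S.name ((T.toEquiv ^ l) x) k = S.name x (k + l) := by
  simp only [name, homeomorph_zpow_add]

theorem occursAt_name_zpow (S : TowerPartition X T V) (x : X) (k l : ℤ) (y : List (V × ℕ)) :
    OccursAt (S.name ((T.toEquiv ^ l) x)) k y ↔ OccursAt (S.name x) (k + l) y := by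
  unfold OccursAt
  simp only [name_zpow, add_right_comm]

/-- Words read between two visits to the base. -/
def BaseWord (S : TowerPartition X T V) (y : List (V × ℕ)) : Prop :=
  ∃ x, S.lvl x = 0 ∧ OccursAt (S.name x) 0 y ∧ S.lvl ((T.toEquiv ^ (y.length : ℤ)) x) = 0

theorem lvl_eq_zero_iff_of_atom_pred (S : TowerPartition X T V) {x y : X}
    (h : S.atom x = S.atom y) : S.lvl (T x) = 0 → S.lvl (T y) = 0 := by
  intro h0
  simp only [atom, Prod.mk.injEq] at h
  apply S.lvl_top
  rw [← h.1, ← h.2]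
  refine le_antisymm (S.lvl_lt x) ?_
  by_contra hlt
  have := S.lvl_succ x (by omega)
  omega

theorem baseWord_of_append (S : TowerPartition X T V) (a g : List (V × ℕ)) (ha : a ≠ [])
    (h1 : S.BaseWord a) (h2 : S.BaseWord (a ++ g)) : S.BaseWord g := by
  obtain ⟨x, -, hx, hxe⟩ := h1
  obtain ⟨y, -, hy, hye⟩ := h2
  rw [occursAt_append] at hy
  refine ⟨(T.toEquiv ^ (a.length : ℤ)) y, ?_, ?_, ?_⟩
  · have hpos : 0 < a.length := List.length_pos_iff.2 ha
    have e1 := hx (a.length - 1) (by omega)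
    have e2 := hy.1 (a.length - 1) (by omega)
    rw [e1] at e2
    have e3 : (0 : ℤ) + ((a.length - 1 : ℕ) : ℤ) + 1 = a.length := by omega
    have := S.lvl_eq_zero_iff_of_atom_pred e2
    rw [← homeomorph_zpow_add_one, ← homeomorph_zpow_add_one, e3] at this
    exact this hxe
  · rw [occursAt_name_zpow]; exact hy.2
  · rw [← homeomorph_zpow_add]
    rw [List.length_append] at hye
    rwa [show (g.length : ℤ) + a.length = ((a.length + g.length : ℕ) : ℤ) by push_cast; ring]

/-- The partition `Q` refines `P`, and the base of `Q` is contained in that of `P`. -/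
def Refines (Q : TowerPartition X T V') (P : TowerPartition X T V) : Prop :=
  (∀ x y, Q.atom x = Q.atom y → P.atom x = P.atom y) ∧ ∀ x, Q.lvl x = 0 → P.lvl x = 0

/-- The word of levels of `P` visited along the tower of `Q` containing `z`. -/
def word (Q : TowerPartition X T V') (P : TowerPartition X T V) (z : X) : List (V × ℕ) :=
  (List.range (Q.ht (Q.vtx z))).map fun i : ℕ => P.atom ((T.toEquiv ^ ((i : ℤ) - Q.lvl z)) z)

@[simp]
theorem length_word (Q : TowerPartition X T V') (P : TowerPartition X T V) (z : X) :
    (Q.word P z).length = Q.ht (Q.vtx z) := by simp [word]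

theorem word_congr {Q : TowerPartition X T V'} {P : TowerPartition X T V} (h : Q.Refines P)
    {z z' : X} (hz : Q.vtx z = Q.vtx z') : Q.word P z = Q.word P z' := by
  refine List.ext_getElem (by simp [hz]) fun i h1 h2 => ?_
  simp only [word, List.getElem_map, List.getElem_range]
  apply h.1
  rw [length_word] at h1 h2
  obtain ⟨a1, a2⟩ := Q.shift z i h1
  obtain ⟨b1, b2⟩ := Q.shift z' i h2
  simp only [atom, a1, a2, b1, b2, hz]

theorem occursAt_word (Q : TowerPartition X T V') (P : TowerPartition X T V) (z : X) :
    OccursAt (P.name z) (-(Q.lvl z : ℤ)) (Q.word P z) := by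
  intro k hk
  simp only [word, List.getElem_map, List.getElem_range, name]
  congr 3; ring

theorem getElem_word_lvl (Q : TowerPartition X T V') (P : TowerPartition X T V) (z : X) :
    (Q.word P z)[Q.lvl z]? = some (P.atom z) := by
  have h : Q.lvl z < (Q.word P z).length := by simpa using Q.lvl_lt z
  rw [List.getElem?_eq_getElem h, Q.occursAt_word P z _ h]
  simp [name]

theorem finite_range_word [Finite V'] {Q : TowerPartition X T V'} {P : TowerPartition X T V}
    (h : Q.Refines P) : (Set.range (Q.word P)).Finite := by
  classical
  have : Q.word P = (fun v => if h : ∃ z, Q.vtx z = v then Q.word P h.choose else []) ∘ Q.vtx := by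
    funext z
    have hz : ∃ z', Q.vtx z' = Q.vtx z := ⟨z, rfl⟩
    simp only [Function.comp, dif_pos hz]
    exact word_congr h hz.choose_spec.symm
  rw [this]
  exact (Set.finite_range _).subset (Set.range_comp_subset_range _ _)

theorem card_range_word_le [Finite V'] {Q : TowerPartition X T V'} {P : TowerPartition X T V}
    (h : Q.Refines P) : (Set.range (Q.word P)).ncard ≤ Nat.card V' ∧
      (Nat.card V' ≤ (Set.range (Q.word P)).ncard →
        ∀ z z', Q.word P z = Q.word P z' → Q.vtx z = Q.vtx z') := by
  classical
  set g : V' → List (V × ℕ) := fun v => if h : ∃ z, Q.vtx z = v then Q.word P h.choose else []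
    with hg
  have hgz : ∀ z, Q.word P z = g (Q.vtx z) := by
    intro z
    have hz : ∃ z', Q.vtx z' = Q.vtx z := ⟨z, rfl⟩
    simp only [hg, dif_pos hz]
    exact word_congr h hz.choose_spec.symm
  have hr : Set.range (Q.word P) = g '' Set.range Q.vtx := by
    rw [← Set.range_comp]; congr 1; funext z; exact hgz z
  have hfin : (Set.range Q.vtx).Finite := Set.toFinite _
  have h1 : (g '' Set.range Q.vtx).ncard ≤ (Set.range Q.vtx).ncard := Set.ncard_image_le hfin
  have h2 : (Set.range Q.vtx).ncard ≤ Nat.card V' := by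
    rw [← Set.ncard_univ]; exact Set.ncard_le_ncard (Set.subset_univ _) (Set.toFinite _)
  rw [hr]
  refine ⟨h1.trans h2, fun h3 z z' hzz' => ?_⟩
  have hinj := (Set.ncard_image_iff hfin).1 (le_antisymm h1 (h2.trans h3))
  rw [hgz, hgz] at hzz'
  exact hinj ⟨z, rfl⟩ ⟨z', rfl⟩ hzz'

theorem baseWord_word {Q : TowerPartition X T V'} {P : TowerPartition X T V} (h : Q.Refines P)
    (z : X) : Q.word P z ≠ [] ∧ P.BaseWord (Q.word P z) := by
  have hlt := Q.lvl_lt z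
  obtain ⟨h1, h2⟩ := Q.down z (Q.lvl z) le_rfl
  have h0 : Q.lvl ((T.toEquiv ^ (-(Q.lvl z : ℤ))) z) = 0 := by omega
  refine ⟨?_, (T.toEquiv ^ (-(Q.lvl z : ℤ))) z, h.2 _ h0, ?_, ?_⟩
  · rw [← List.length_pos_iff, length_word]; omega
  · rw [occursAt_name_zpow, zero_add]; exact Q.occursAt_word P z
  · apply h.2
    rw [length_word, ← h1]
    exact Q.lvl_zpow_ht _ h0

theorem isFactorization [Finite V'] {Q : TowerPartition X T V'} {P : TowerPartition X T V}
    (h : Q.Refines P) (x : X) :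
    IsFactorization (P.name x) (finite_range_word h).toFinset {k | Q.lvl ((T.toEquiv ^ k) x) = 0}
      fun k => Q.word P ((T.toEquiv ^ k) x) where
  mem i _ := by simp
  occ i hi := by
    have := Q.occursAt_word P ((T.toEquiv ^ i) x)
    rw [show Q.lvl ((T.toEquiv ^ i) x) = 0 from hi, occursAt_name_zpow] at this
    simpa using this
  next i hi := by
    have := Q.lvl_zpow_ht _ hi
    rw [← homeomorph_zpow_add] at this
    simpa [add_comm] using this
  gap i hi k h1 h2 := by
    rw [length_word] at h2
    have h0 : Q.lvl ((T.toEquiv ^ i) x) = 0 := hi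
    have := (Q.up ((T.toEquiv ^ i) x) (k - i).toNat (by omega)).2
    rw [← homeomorph_zpow_add, show (((k - i).toNat : ℕ) : ℤ) + i = k by omega] at this
    simp only [Set.mem_ofPred_eq]
    omega
  cover k := by
    set z := (T.toEquiv ^ k) x with hz
    obtain ⟨h1, h2⟩ := Q.down z (Q.lvl z) le_rfl
    have hk : (T.toEquiv ^ (k - Q.lvl z)) x = (T.toEquiv ^ (-(Q.lvl z : ℤ))) z := by
      rw [hz, ← homeomorph_zpow_add]; congr 2; ring
    refine ⟨k - Q.lvl z, ?_, by omega, ?_⟩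
    · simp only [Set.mem_ofPred_eq, hk]; omega
    · rw [hk, length_word, h1]
      have := Q.lvl_lt z
      omega

end TowerPartition

/-- The word of the list `L` containing the letter of rank `l` of the concatenation of `L`, and the
rank of that letter in this word. -/
def locate {α : Type*} : List (List α) → ℕ → List α × ℕ
  | [], _ => ([], 0)
  | f :: L, l => if l < f.length then (f, l) else locate L (l - f.length)

section Locate

variable {α : Type*}

theorem locate_spec (L : List (List α)) (l : ℕ) (h : l < L.flatten.length) :
    (locate L l).1 ∈ L ∧ (locate L l).2 < (locate L l).1.length ∧
      (locate L l).1[(locate L l).2]? = L.flatten[l]? := by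
  induction L generalizing l with
  | nil => simp at h
  | cons f L ih =>
    rw [List.flatten_cons, List.length_append] at h
    rw [locate]
    split_ifs with hl
    · refine ⟨by simp, hl, ?_⟩
      rw [List.flatten_cons, List.getElem?_append_left hl]
    · obtain ⟨h1, h2, h3⟩ := ih (l - f.length) (by omega)
      refine ⟨List.mem_cons_of_mem _ h1, h2, ?_⟩
      rw [h3, List.flatten_cons, List.getElem?_append_right (by omega)]

theorem locate_succ (L : List (List α)) (l : ℕ) (h : l < L.flatten.length)
    (h' : (locate L l).2 + 1 < (locate L l).1.length) :
    l + 1 < L.flatten.length ∧ locate L (l + 1) = ((locate L l).1, (locate L l).2 + 1) := by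
  induction L generalizing l with
  | nil => simp at h
  | cons f L ih =>
    rw [List.flatten_cons, List.length_append] at h ⊢
    simp only [locate] at h' ⊢
    by_cases hl : l < f.length
    · rw [if_pos hl] at h' ⊢
      simp only at h'
      rw [if_pos h']
      exact ⟨by omega, rfl⟩
    · rw [if_neg hl] at h' ⊢
      obtain ⟨h1, h2⟩ := ih (l - f.length) (by omega) h'
      rw [if_neg (by omega), show l + 1 - f.length = l - f.length + 1 by omega]
      exact ⟨by omega, h2⟩

theorem locate_zero (L : List (List α)) (hL : [] ∉ L) : (locate L 0).2 = 0 := by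
  cases L with
  | nil => rfl
  | cons f L =>
    have : 0 < f.length := List.length_pos_iff.2 (by rintro rfl; simp at hL)
    rw [locate, if_pos this]

theorem locate_top (L : List (List α)) (hL : [] ∉ L) (l : ℕ) (h : l < L.flatten.length)
    (h' : (locate L l).2 + 1 = (locate L l).1.length) : (locate L (l + 1)).2 = 0 := by
  induction L generalizing l with
  | nil => simp at h
  | cons f L ih =>
    rw [List.flatten_cons, List.length_append] at h
    have hL' : [] ∉ L := fun h => hL (List.mem_cons_of_mem _ h)
    simp only [locate] at h' ⊢
    by_cases hl : l < f.length
    · rw [if_pos hl] at h'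
      simp only at h'
      rw [if_neg (by omega), show l + 1 - f.length = 0 by omega]
      exact locate_zero L hL'
    · rw [if_neg hl] at h'
      rw [if_neg (by omega), show l + 1 - f.length = l - f.length + 1 by omega]
      exact ih hL' _ (by omega) h'

end Locate

namespace TowerPartition

variable {X : Type} [TopologicalSpace X] {T : X ≃ₜ X} {V V' : Type}

/-- If the words of the towers of `Q` over `P` are spanned by `F`, there is a partition with towers
indexed by `F` in between `P` and `Q`. -/
theorem exists_intermediate [Finite V'] {Q : TowerPartition X T V'} {P : TowerPartition X T V}
    (h : Q.Refines P) (F : Finset (List (V × ℕ))) (hF : ∀ f ∈ F, f ≠ [] ∧ P.BaseWord f)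
    (hspan : ∀ z, SpannedBy F (Q.word P z)) :
    ∃ R : TowerPartition X T {f // f ∈ F}, Q.Refines R ∧ R.Refines P := by
  have hsp' : ∀ y : Set.range (Q.word P), SpannedBy F y.1 := by
    rintro ⟨_, z, rfl⟩; exact hspan z
  choose M hM hMf using hsp'
  set L : X → List (List (V × ℕ)) := fun z => M ⟨Q.word P z, z, rfl⟩ with hLdef
  have hLF : ∀ z, ∀ f ∈ L z, f ∈ F := fun z => hM _
  have hLf : ∀ z, (L z).flatten = Q.word P z := fun z => hMf _
  have hLc : ∀ z z', Q.vtx z = Q.vtx z' → L z = L z' := by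
    intro z z' hz
    simp only [hLdef]
    congr 2
    exact word_congr h hz
  have hL0 : ∀ z, [] ∉ L z := fun z h0 => (hF _ (hLF z _ h0)).1 rfl
  have hlen : ∀ z, (L z).flatten.length = Q.ht (Q.vtx z) := fun z => by rw [hLf, length_word]
  have hlt : ∀ z, Q.lvl z < (L z).flatten.length := fun z => by rw [hlen]; exact Q.lvl_lt z
  have hspec := fun z => locate_spec (L z) (Q.lvl z) (hlt z)
  have hcongr : ∀ z z', Q.atom z = Q.atom z' →
      locate (L z) (Q.lvl z) = locate (L z') (Q.lvl z') := by
    intro z z' hz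
    simp only [atom, Prod.mk.injEq] at hz
    rw [hLc z z' hz.1, hz.2]
  have hsucc : ∀ x, (locate (L x) (Q.lvl x)).2 + 1 < (locate (L x) (Q.lvl x)).1.length →
      locate (L (T x)) (Q.lvl (T x)) =
        ((locate (L x) (Q.lvl x)).1, (locate (L x) (Q.lvl x)).2 + 1) := by
    intro x hx
    obtain ⟨h1, h2⟩ := locate_succ (L x) (Q.lvl x) (hlt x) hx
    rw [hlen] at h1
    rw [hLc _ _ (Q.vtx_succ x h1), Q.lvl_succ x h1, h2]
  let R : TowerPartition X T {f // f ∈ F} :=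
    { vtx := fun z => ⟨(locate (L z) (Q.lvl z)).1, hLF z _ (hspec z).1⟩
      lvl := fun z => (locate (L z) (Q.lvl z)).2
      ht := fun f => f.1.length
      isLocallyConstant := by
        rw [IsLocallyConstant.iff_eventually_eq]
        intro x
        filter_upwards [(IsLocallyConstant.iff_eventually_eq _).1 Q.isLocallyConstant x] with y hy
        have := hcongr y x hy
        simp only [this]
      lvl_lt := fun z => (hspec z).2.1
      vtx_succ := fun x hx => Subtype.ext (by simp only [hsucc x hx])
      lvl_succ := fun x hx => by simp only [hsucc x hx]
      lvl_top := fun x hx => by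
        rcases (Nat.succ_le_of_lt (Q.lvl_lt x)).lt_or_eq with hlt' | heq
        · rw [hLc _ _ (Q.vtx_succ x hlt'), Q.lvl_succ x hlt']
          exact locate_top (L x) (hL0 x) _ (hlt x) hx
        · rw [Q.lvl_top x heq]
          exact locate_zero _ (hL0 _) }
  refine ⟨R, ⟨fun x y hxy => ?_, fun x hx => ?_⟩, fun x y hxy => ?_, fun x hx => ?_⟩
  · have := hcongr x y hxy
    simp only [atom, R, this]
  · simp only [R, hx]
    exact locate_zero _ (hL0 _)
  · simp only [atom, R, Prod.mk.injEq, Subtype.mk.injEq] at hxy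
    have h1 := (hspec x).2.2
    rw [hLf, getElem_word_lvl, hxy.1, hxy.2, (hspec y).2.2, hLf, getElem_word_lvl] at h1
    exact (Option.some.inj h1).symm
  · have hx' : (locate (L x) (Q.lvl x)).2 = 0 := hx
    have h1 := (hspec x).2.2
    have h2 := (hspec x).2.1
    rw [hLf, getElem_word_lvl, hx'] at h1
    rw [hx'] at h2
    obtain ⟨z, hz0, hz, -⟩ := (hF _ (hLF x _ (hspec x).1)).2
    have h3 := hz 0 h2
    rw [List.getElem?_eq_getElem h2, h3] at h1
    have h4 := Option.some.inj h1
    simp only [name, add_zero, Nat.cast_zero, zpow_zero, Equiv.Perm.coe_one, id_eq, atom,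
      Prod.mk.injEq] at h4
    rw [← h4.2]; exact hz0

end TowerPartition

namespace TowerPartition

variable {X : Type} [MetricSpace X] {T : X ≃ₜ X} {V V' : Type}

theorem exists_dist_lt_atom_eq [CompactSpace X] (S : TowerPartition X T V) :
    ∃ δ > 0, ∀ x y, dist x y < δ → S.atom x = S.atom y := by
  obtain ⟨δ, hδ, h⟩ := lebesgue_number_lemma_of_metric (isCompact_univ (X := X))
    (c := fun a : V × ℕ => S.atom ⁻¹' {a}) (fun a => S.isLocallyConstant {a})
    (fun x _ => Set.mem_iUnion.2 ⟨S.atom x, rfl⟩)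
  refine ⟨δ, hδ, fun x y hxy => ?_⟩
  obtain ⟨a, ha⟩ := h x (Set.mem_univ x)
  rw [show S.atom x = a from ha (Metric.mem_ball_self hδ),
    show S.atom y = a from ha (by rwa [Metric.mem_ball, dist_comm])]

theorem name_locallyConstant (S : TowerPartition X T V) (k : ℤ) :
    IsLocallyConstant fun x => S.name x k :=
  S.isLocallyConstant.comp_continuous (homeomorph_continuous_zpow T k)

/-- If a name is periodic, all names are. -/
theorem name_periodic (hmin : ∀ x : X, Dense (Set.range fun n : ℤ => (T.toEquiv ^ n) x))
    (P : TowerPartition X T V) {x : X} {N : ℤ} (hx : ∀ i, P.name x (i + N) = P.name x i) (z : X)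
    (i : ℤ) : P.name z (i + N) = P.name z i := by
  have h1 := P.name_locallyConstant (i + N)
  have h2 := P.name_locallyConstant i
  by_contra hne
  have hopen : IsOpen {y | ¬ P.name y (i + N) = P.name y i} :=
    (h1.prodMk h2) {q : (V × ℕ) × (V × ℕ) | ¬ q.1 = q.2}
  obtain ⟨_, hy, n, rfl⟩ := (hmin x).inter_open_nonempty _ hopen ⟨z, hne⟩
  apply hy
  simp only [name_zpow]
  rw [show i + N + n = i + n + N by ring, hx]

/-- A partition with periodic names is refined by a partition with a single tower. -/
theorem exists_single_tower (hmin : ∀ x : X, Dense (Set.range fun n : ℤ => (T.toEquiv ^ n) x))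
    (P : TowerPartition X T V) {x₀ : X} (h₀ : P.lvl x₀ = 0) {x : X} {N : ℤ} (hN : 0 < N)
    (hx : ∀ i, P.name x (i + N) = P.name x i) :
    ∃ R : TowerPartition X T Unit, R.lvl x₀ = 0 ∧ R.Refines P := by
  classical
  have hper := P.name_periodic hmin hx
  have hmul : ∀ z i, ∀ m : ℕ, P.name z (i + m * N) = P.name z i := by
    intro z i m
    induction m with
    | zero => simp
    | succ m ih => rw [← ih, ← hper z (i + m * N)]; congr 1; push_cast; ring
  have hloc : ∀ z, ∀ᶠ y in nhds z, P.name y = P.name z := by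
    intro z
    have : ∀ᶠ y in nhds z, ∀ k ∈ Finset.Ico 0 N, P.name y k = P.name z k := by
      rw [Filter.eventually_all_finset]
      intro k _
      exact (IsLocallyConstant.iff_eventually_eq _).1 (P.name_locallyConstant k) z
    filter_upwards [this] with y hy
    have hmod : ∀ u i, P.name u i = P.name u (i % N) := by
      intro u i
      have e := Int.emod_add_mul_ediv i N
      rcases le_total 0 (i / N) with h | h
      · rw [← hmul u (i % N) (i / N).toNat, Int.toNat_of_nonneg h]
        congr 1; linarith
      · rw [← hmul u i (-(i / N)).toNat, Int.toNat_of_nonneg (by omega)]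
        congr 1; linarith
    funext i
    rw [hmod y, hmod z]
    exact hy _ (Finset.mem_Ico.2 ⟨Int.emod_nonneg _ hN.ne', Int.emod_lt_of_pos _ hN⟩)
  have hT : ∀ z k, P.name (T z) k = P.name z (k + 1) := fun z k => P.name_zpow z k 1
  have hexl : ∀ z, ∃ l : ℕ, ∀ k, P.name z (k - l) = P.name x₀ k := by
    intro z
    obtain ⟨U, hU, hUo, hxU⟩ := mem_nhds_iff.1 (hloc x₀)
    obtain ⟨_, hy, n, rfl⟩ := (hmin z).inter_open_nonempty _ hUo ⟨x₀, hxU⟩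
    have h1 : P.name ((T.toEquiv ^ n) z) = P.name x₀ := hU hy
    refine ⟨(n.toNat * N - n).toNat, fun k => ?_⟩
    rw [← h1, P.name_zpow, ← hmul z _ n.toNat]
    congr 1
    have : n ≤ n.toNat * N := by
      rcases le_total 0 n with h | h
      · rw [Int.toNat_of_nonneg h]; nlinarith
      · rw [Int.toNat_of_nonpos h]; simpa using h
    rw [Int.toNat_of_nonneg (by omega)]
    ring
  have hexp : ∃ p : ℕ, 0 < p ∧ ∀ k, P.name x₀ (k + p) = P.name x₀ k :=
    ⟨N.toNat, by omega, fun k => by rw [Int.toNat_of_nonneg hN.le, hper]⟩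
  set p := Nat.find hexp with hp
  obtain ⟨hp0, hpp⟩ := Nat.find_spec hexp
  have hpm : ∀ q : ℕ, 0 < q → (∀ k, P.name x₀ (k + q) = P.name x₀ k) → p ≤ q :=
    fun q h1 h2 => Nat.find_min' hexp ⟨h1, h2⟩
  set l : X → ℕ := fun z => Nat.find (hexl z) with hl
  have hls : ∀ z k, P.name z (k - l z) = P.name x₀ k := fun z => Nat.find_spec (hexl z)
  have hlm : ∀ z (j : ℕ), (∀ k, P.name z (k - j) = P.name x₀ k) → l z ≤ j :=
    fun z j h => Nat.find_min' (hexl z) h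
  have hlt : ∀ z, l z < p := by
    intro z
    by_contra hle
    have := hlm z (l z - p) fun k => by
      rw [← hpp k, ← hls z, Nat.cast_sub (by omega)]; congr 1; ring
    omega
  have hlat : ∀ z, P.atom z = P.name x₀ (l z) := by
    intro z
    rw [← hls z, sub_self]; simp [name]
  let R : TowerPartition X T Unit :=
    { vtx := fun _ => ()
      lvl := l
      ht := fun _ => p
      isLocallyConstant := by
        rw [IsLocallyConstant.iff_eventually_eq]
        intro z
        filter_upwards [hloc z] with y hy
        have : l y = l z := by simp only [hl, hy]
        rw [this]
      lvl_lt := hlt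
      vtx_succ := fun _ _ => rfl
      lvl_succ := fun z hz => by
        refine le_antisymm (hlm _ _ fun k => ?_) ?_
        · rw [hT, ← hls z]; congr 1; push_cast; ring
        · by_contra hlt'
          rcases Nat.eq_zero_or_pos (l (T z)) with h0 | h0
          · have := hpm (l z + 1) (by omega) fun k => by
              rw [← hls z, ← hls (T z) k, hT, h0]; congr 1; push_cast; ring
            omega
          · have := hlm z (l (T z) - 1) fun k => by
              rw [← hls (T z) k, hT, Nat.cast_sub h0]; congr 1; push_cast; ring
            omega
      lvl_top := fun z hz => by
        refine Nat.le_zero.1 (hlm _ _ fun k => ?_)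
        have hz' : ((l z : ℕ) : ℤ) + 1 = p := by exact_mod_cast hz
        rw [hT, ← hpp k, ← hls z, ← hz']; congr 1; push_cast; ring }
  have hR0 : R.lvl x₀ = 0 := Nat.le_zero.1 (hlm _ _ fun k => by simp)
  refine ⟨R, hR0, fun y z hyz => ?_, fun y hy => ?_⟩
  · have : l y = l z := congrArg Prod.snd hyz
    rw [hlat, hlat, this]
  · have h1 := hlat y
    rw [show l y = 0 from hy] at h1
    have : P.lvl y = P.lvl x₀ := by simpa [name, atom] using congrArg Prod.snd h1
    rw [this, h₀]

/-- If `x` and `y` have the same names, and visit the base at the same times, they lie in the same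
level. -/
theorem atom_eq_of_cuts_eq {Q : TowerPartition X T V'} {P : TowerPartition X T V}
    (hinj : ∀ z z', Q.word P z = Q.word P z' → Q.vtx z = Q.vtx z') {x y : X}
    (hname : P.name x = P.name y)
    (hcuts : {k : ℤ | Q.lvl ((T.toEquiv ^ k) x) = 0} = {k : ℤ | Q.lvl ((T.toEquiv ^ k) y) = 0}) :
    Q.atom x = Q.atom y := by
  have hle : ∀ {x y : X}, {k : ℤ | Q.lvl ((T.toEquiv ^ k) x) = 0} =
      {k : ℤ | Q.lvl ((T.toEquiv ^ k) y) = 0} →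
      Q.lvl x ≤ Q.lvl y ∧ (Q.lvl x = Q.lvl y → Q.ht (Q.vtx x) ≤ Q.ht (Q.vtx y)) := by
    intro x y hcuts
    have hc : ∀ k : ℤ, Q.lvl ((T.toEquiv ^ k) x) = 0 ↔ Q.lvl ((T.toEquiv ^ k) y) = 0 :=
      fun k => Set.ext_iff.1 hcuts k
    constructor
    · by_contra hlt
      have h1 := (Q.down x (Q.lvl y) (by omega)).2
      have h2 := (Q.down y (Q.lvl y) le_rfl).2
      rw [(hc _).2 (by omega)] at h1
      omega
    · intro heq
      by_contra hlt
      have hy := Q.lvl_lt y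
      have h1 := (Q.up x (Q.ht (Q.vtx y) - Q.lvl y) (by omega)).2
      rw [(hc _).2 (Q.lvl_zpow_ht_sub_lvl y)] at h1
      omega
  obtain ⟨h1, h2⟩ := hle hcuts
  obtain ⟨h3, h4⟩ := hle hcuts.symm
  have hl := le_antisymm h1 h3
  have hht := le_antisymm (h2 hl) (h4 hl.symm)
  have hw : Q.word P x = Q.word P y := by
    have o1 := Q.occursAt_word P x
    have o2 := Q.occursAt_word P y
    rw [← hname, ← hl] at o2
    exact o1.eq_of_length_eq o2 (by simpa using hht)
  simp only [atom, hinj _ _ hw, hl]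

end TowerPartition

theorem HasFineTowers.exists_refines {X : Type} [MetricSpace X] [CompactSpace X] {T : X ≃ₜ X}
    {x₀ : X} {K : ℕ} (h : HasFineTowers X T x₀ K) {V : Type} (P : TowerPartition X T V)
    (h₀ : P.lvl x₀ = 0) {ε : ℝ} (hε : 0 < ε) :
    ∃ (V' : Type) (_ : Finite V') (Q : TowerPartition X T V'), Nat.card V' ≤ K ∧
      Q.lvl x₀ = 0 ∧ Q.Refines P ∧ (∀ x, Q.lvl x = 0 → dist x x₀ < ε) ∧
      ∀ x y, Q.atom x = Q.atom y → dist x y < ε := by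
  obtain ⟨δ, hδ, hP⟩ := P.exists_dist_lt_atom_eq
  obtain ⟨V', hV', Q, hc, hQ0, hb, ha⟩ := h (min ε δ) (lt_min hε hδ)
  simp only [lt_min_iff] at hb ha
  refine ⟨V', hV', Q, hc, hQ0, ⟨fun x y hxy => hP _ _ ?_, fun x hx => ?_⟩,
    fun x hx => (hb x hx).1, fun x y hxy => ?_⟩
  · exact (ha x y (congrArg Prod.fst hxy) (congrArg Prod.snd hxy)).2
  · rw [← h₀]
    exact congrArg Prod.snd (hP _ _ (hb x hx).2)
  · exact (ha x y (congrArg Prod.fst hxy) (congrArg Prod.snd hxy)).1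

/-- A minimal system with fine partitions into `d` towers, but not into fewer towers or into a
single one, is expansive. -/
theorem HasFineTowers.expansive {X : Type} [MetricSpace X] [CompactSpace X] {T : X ≃ₜ X}
    (hmin : ∀ x : X, Dense (Set.range fun n : ℤ => (T.toEquiv ^ n) x)) {x₀ : X} {d : ℕ}
    (hd : HasFineTowers X T x₀ d) (hd' : ¬ HasFineTowers X T x₀ (d - 1))
    (h1 : ¬ HasFineTowers X T x₀ 1) :
    ∃ δ : ℝ, 0 < δ ∧ ∀ x y : X, x ≠ y →
      ∃ m : ℤ, δ < dist ((T.toEquiv ^ m) x) ((T.toEquiv ^ m) y) := by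
  classical
  obtain ⟨ε, hε, hnot⟩ : ∃ ε > 0, ∀ (V : Type) (_ : Finite V) (S : TowerPartition X T V),
      S.lvl x₀ = 0 → (∀ x, S.lvl x = 0 → dist x x₀ < ε) →
      (∀ x y, S.atom x = S.atom y → dist x y < ε) → d - 1 < Nat.card V := by
    unfold HasFineTowers at hd'
    push Not at hd'
    obtain ⟨ε, hε, h⟩ := hd'
    refine ⟨ε, hε, fun V hV S h0 hb ha => ?_⟩
    by_contra hc
    obtain ⟨x, y, e1, e2, hxy⟩ := h V hV S (by omega) h0 hb
    exact absurd (ha x y (Prod.ext e1 e2)) (not_lt.2 hxy)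
  obtain ⟨ε₁, hε₁, hnot₁⟩ : ∃ ε > 0, ∀ (S : TowerPartition X T Unit),
      S.lvl x₀ = 0 → (∀ x, S.lvl x = 0 → dist x x₀ < ε) →
      ¬ ∀ x y, S.atom x = S.atom y → dist x y < ε := by
    unfold HasFineTowers at h1
    push Not at h1
    obtain ⟨ε, hε, h⟩ := h1
    refine ⟨ε, hε, fun S h0 hb ha => ?_⟩
    obtain ⟨x, y, e1, e2, hxy⟩ := h Unit inferInstance S (by simp) h0 hb
    exact absurd (ha x y (Prod.ext e1 e2)) (not_lt.2 hxy)
  obtain ⟨V, hV, P, -, hP0, hPb, hPa⟩ := hd (min ε ε₁) (lt_min hε hε₁)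
  simp only [lt_min_iff] at hPb hPa
  have hW : ∀ x, ∀ N : ℤ, 0 < N → ∃ i, P.name x (i + N) ≠ P.name x i := by
    intro x N hN
    by_contra! hper
    obtain ⟨R, hR0, hR1, hR2⟩ := P.exists_single_tower hmin hP0 hN hper
    refine hnot₁ R hR0 (fun x hx => (hPb x (hR2 x hx)).2) fun x y hxy => ?_
    have := hR1 x y hxy
    exact (hPa x y (congrArg Prod.fst this) (congrArg Prod.snd this)).2
  obtain ⟨δ, hδ, hPδ⟩ := P.exists_dist_lt_atom_eq
  refine ⟨δ / 2, half_pos hδ, fun x y hxy => ?_⟩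
  by_contra! hclose
  have hname : P.name x = P.name y := by
    funext k
    exact hPδ _ _ ((hclose k).trans_lt (half_lt_self hδ))
  obtain ⟨V', hV', Q, hc, hQ0, hQP, hQb, hQa⟩ := hd.exists_refines P hP0 (dist_pos.2 hxy)
  set Y := (TowerPartition.finite_range_word hQP).toFinset with hY
  have hYg : ∀ y ∈ Y, y ≠ [] ∧ P.BaseWord y := by
    intro y hy
    obtain ⟨z, rfl⟩ := (Set.Finite.mem_toFinset _).1 hy
    exact TowerPartition.baseWord_word hQP z
  have hdle : ∀ F : Finset (List (V × ℕ)), (∀ f ∈ F, f ≠ [] ∧ P.BaseWord f) →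
      (∀ y ∈ Y, SpannedBy F y) → d ≤ F.card := by
    intro F hF hsp
    obtain ⟨R, hQR, hRP⟩ := TowerPartition.exists_intermediate hQP F hF fun z =>
      hsp _ ((Set.Finite.mem_toFinset _).2 ⟨z, rfl⟩)
    have := hnot _ inferInstance R (hQR.2 _ hQ0) (fun x hx => (hPb x (hRP.2 x hx)).1)
      fun x y hxy => by
        have := hRP.1 x y hxy
        exact (hPa x y (congrArg Prod.fst this) (congrArg Prod.snd this)).1
    rw [Nat.card_eq_fintype_card, Fintype.card_coe] at this
    omega
  have hcard := TowerPartition.card_range_word_le hQP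
  rw [Set.ncard_eq_toFinset_card _ (TowerPartition.finite_range_word hQP), ← hY] at hcard
  have hYd := hdle Y hYg fun y hy => SpannedBy.of_mem hy
  have hinj := hcard.2 (hc.trans hYd)
  have hYe : Elementary P.BaseWord Y := fun F hF hsp =>
    hcard.1.trans (hc.trans (hdle F hF hsp))
  have hfx := TowerPartition.isFactorization hQP x
  have hfy := TowerPartition.isFactorization hQP y
  rw [← hname] at hfy
  have hP0 : ∀ k : ℤ, k ∈ {k : ℤ | Q.lvl ((T.toEquiv ^ k) x) = 0} ∪
      {k : ℤ | Q.lvl ((T.toEquiv ^ k) y) = 0} → P.lvl ((T.toEquiv ^ k) x) = 0 := by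
    rintro k (hk | hk)
    · exact hQP.2 _ hk
    · have : P.lvl ((T.toEquiv ^ k) x) = P.lvl ((T.toEquiv ^ k) y) :=
        congrArg Prod.snd (congrFun hname k)
      rw [this]
      exact hQP.2 _ hk
  have hcuts := hYe.cuts_eq P.baseWord_of_append hYg hfx hfy
    (fun i g _ hocc hi hig => ⟨(T.toEquiv ^ i) x, hP0 i hi, by
      rw [TowerPartition.occursAt_name_zpow, zero_add]; exact hocc, by
      rw [← homeomorph_zpow_add, add_comm]; exact hP0 _ hig⟩) (hW x)
  exact lt_irrefl _ (hQa x y (TowerPartition.atom_eq_of_cuts_eq hinj hname hcuts))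

/-- The sum of `h` over the elements smaller than `a`. -/
def initialSum {α : Type*} [LinearOrder α] [Fintype α] (h : α → ℕ) (a : α) : ℕ :=
  ∑ b with b < a, h b

section InitialSum

variable {α : Type*} [LinearOrder α] [Fintype α] (h : α → ℕ)

theorem initialSum_add (a : α) : initialSum h a + h a = ∑ b with b ≤ a, h b := by
  rw [initialSum, add_comm, ← Finset.sum_insert (by simp)]
  congr 1
  ext b
  simp [le_iff_eq_or_lt]

theorem initialSum_add_le_of_lt {a b : α} (hab : a < b) :
    initialSum h a + h a ≤ initialSum h b := by
  rw [initialSum_add, initialSum]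
  refine Finset.sum_le_sum_of_subset fun c hc => ?_
  simp only [Finset.mem_filter_univ] at hc ⊢
  exact hc.trans_lt hab

theorem initialSum_add_eq_of_succ {a b : α} (hab : a < b) (hb : ∀ c, a < c → b ≤ c) :
    initialSum h a + h a = initialSum h b := by
  rw [initialSum_add, initialSum]
  congr 1
  ext c
  simp only [Finset.mem_filter_univ]
  exact ⟨fun hc => hc.trans_lt hab, fun hc => not_lt.1 fun hac => (hb c hac).not_gt hc⟩

theorem initialSum_add_le (a : α) : initialSum h a + h a ≤ ∑ b, h b := by
  rw [initialSum_add]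
  exact Finset.sum_le_sum_of_subset (Finset.filter_subset _ _)

theorem initialSum_add_eq_iff (hpos : ∀ a, 0 < h a) (a : α) :
    initialSum h a + h a = ∑ b, h b ↔ ∀ b, b ≤ a := by
  constructor
  · intro heq b
    by_contra hlt
    have h1 := initialSum_add_le_of_lt h (not_le.1 hlt)
    have h2 := initialSum_add_le h b
    have := hpos b
    omega
  · intro ha
    rw [initialSum_add]
    congr 1
    ext b
    simp [ha b]

theorem initialSum_eq_zero_iff (hpos : ∀ a, 0 < h a) (a : α) :
    initialSum h a = 0 ↔ ∀ b, a ≤ b := by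
  simp only [initialSum, Finset.sum_eq_zero_iff, Finset.mem_filter_univ]
  exact ⟨fun H b => not_lt.1 fun hb => (hpos b).ne' (H b hb), fun H b hb => absurd (H b) hb.not_ge⟩

end InitialSum

namespace BratteliDiagram

variable {B : BratteliDiagram}

open Classical in
/-- The number of finite paths from the root to a vertex. -/
noncomputable def towerHeight (B : BratteliDiagram) : ∀ n, B.V n → ℕ
  | 0, _ => 1
  | n + 1, v => ∑ e : { e : B.E n // B.rng n e = v }, towerHeight B n (B.src n e.1)

theorem towerHeight_pos : ∀ n (v : B.V n), 0 < B.towerHeight n v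
  | 0, _ => Nat.one_pos
  | n + 1, v => by
    classical
    obtain ⟨e, he⟩ := B.rng_surj n v
    rw [towerHeight]
    exact Finset.sum_pos (fun e _ => towerHeight_pos n _) ⟨⟨e, he⟩, Finset.mem_univ _⟩

open Classical in
/-- The number of finite paths ending with a predecessor of the edge `a`. -/
noncomputable def offset (ω : B.OrderOn) {n : ℕ} {v : B.V (n + 1)}
    (a : { e : B.E n // B.rng n e = v }) : ℕ :=
  @initialSum _ (ω n v) _ (fun f => B.towerHeight n (B.src n f.1)) a

/-- The number of finite paths ending with a predecessor of the edge `e`. -/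
noncomputable def edgeOffset (ω : B.OrderOn) {n : ℕ} (e : B.E n) : ℕ := offset ω ⟨e, rfl⟩

theorem offset_eq_edgeOffset (ω : B.OrderOn) {n : ℕ} {v : B.V (n + 1)}
    (a : { e : B.E n // B.rng n e = v }) : offset ω a = edgeOffset ω a.1 := by
  obtain ⟨e, rfl⟩ := a; rfl

/-- The rank of the beginning of length `n` of the path `x` in its tower. -/
noncomputable def pathLevel (ω : B.OrderOn) : ℕ → B.PathSpace → ℕ
  | 0, _ => 0
  | n + 1, x => pathLevel ω n x + edgeOffset ω (x.1 n)

section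

variable (ω : B.OrderOn)

theorem edgeOffset_add_eq_of_isSuccEdge {n : ℕ} {e e' : B.E n} (h : IsSuccEdge ω e e') :
    edgeOffset ω e + B.towerHeight n (B.src n e) = edgeOffset ω e' := by
  classical
  obtain ⟨hr, h1, h2⟩ := h
  rw [← offset_eq_edgeOffset ω ⟨e', hr⟩]
  exact @initialSum_add_eq_of_succ _ (ω n (B.rng n e)) _ _ _ _ h1 h2

theorem edgeOffset_add_le {n : ℕ} (e : B.E n) :
    edgeOffset ω e + B.towerHeight n (B.src n e) ≤ B.towerHeight (n + 1) (B.rng n e) := by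
  classical
  exact @initialSum_add_le _ (ω n (B.rng n e)) _ _ _

theorem edgeOffset_add_eq_iff {n : ℕ} (e : B.E n) :
    edgeOffset ω e + B.towerHeight n (B.src n e) = B.towerHeight (n + 1) (B.rng n e) ↔
      IsMaxEdge ω e := by
  classical
  exact @initialSum_add_eq_iff _ (ω n (B.rng n e)) _ _ (fun _ => towerHeight_pos _ _) _

theorem edgeOffset_eq_zero_iff {n : ℕ} (e : B.E n) : edgeOffset ω e = 0 ↔ IsMinEdge ω e := by
  classical
  exact @initialSum_eq_zero_iff _ (ω n (B.rng n e)) _ _ (fun _ => towerHeight_pos _ _) _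

theorem edgeOffset_injective {n : ℕ} {e e' : B.E n} (hr : B.rng n e = B.rng n e') {i j : ℕ}
    (hi : i < B.towerHeight n (B.src n e)) (hj : j < B.towerHeight n (B.src n e'))
    (hij : i + edgeOffset ω e = j + edgeOffset ω e') : e = e' := by
  classical
  rw [← offset_eq_edgeOffset ω ⟨e, hr⟩, edgeOffset] at hij
  rcases @lt_trichotomy _ (ω n (B.rng n e')) ⟨e, hr⟩ ⟨e', rfl⟩ with h | h | h
  · have := @initialSum_add_le_of_lt _ (ω n (B.rng n e')) _
      (fun f => B.towerHeight n (B.src n f.1)) _ _ h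
    unfold offset at hij
    dsimp only at this
    omega
  · exact congrArg Subtype.val h
  · have := @initialSum_add_le_of_lt _ (ω n (B.rng n e')) _
      (fun f => B.towerHeight n (B.src n f.1)) _ _ h
    unfold offset at hij
    dsimp only at this
    omega

theorem pathLevel_lt (n : ℕ) (x : B.PathSpace) :
    pathLevel ω n x < B.towerHeight n (B.endVtx n x) := by
  induction n with
  | zero => exact Nat.one_pos
  | succ n ih =>
    have := edgeOffset_add_le ω (x.1 n)
    rw [pathLevel, endVtx, ← x.2 n]
    rw [endVtx] at ih
    omega

theorem pathLevel_add_one_eq_iff (n : ℕ) (x : B.PathSpace) :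
    pathLevel ω n x + 1 = B.towerHeight n (B.endVtx n x) ↔ ∀ i < n, IsMaxEdge ω (x.1 i) := by
  induction n with
  | zero => simp [pathLevel, towerHeight]
  | succ n ih =>
    have h1 := edgeOffset_add_le ω (x.1 n)
    have h2 := pathLevel_lt ω n x
    rw [Nat.forall_lt_succ_right, ← ih, ← edgeOffset_add_eq_iff, pathLevel, endVtx, ← x.2 n]
    rw [endVtx] at h2 ⊢
    omega

theorem pathLevel_eq_zero_iff (n : ℕ) (x : B.PathSpace) :
    pathLevel ω n x = 0 ↔ ∀ i < n, IsMinEdge ω (x.1 i) := by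
  induction n with
  | zero => simp [pathLevel]
  | succ n ih =>
    rw [Nat.forall_lt_succ_right, ← ih, ← edgeOffset_eq_zero_iff, pathLevel, Nat.add_eq_zero_iff]

theorem eq_of_pathLevel_eq (n : ℕ) {x y : B.PathSpace} (h : B.endVtx n x = B.endVtx n y)
    (h' : pathLevel ω n x = pathLevel ω n y) : ∀ i < n, x.1 i = y.1 i := by
  induction n with
  | zero => simp
  | succ n ih =>
    rw [Nat.forall_lt_succ_right]
    rw [endVtx, endVtx, ← x.2 n, ← y.2 n] at h
    have hn : x.1 n = y.1 n := edgeOffset_injective ω h (pathLevel_lt ω n x) (pathLevel_lt ω n y) h'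
    refine ⟨ih (by rw [endVtx, endVtx, hn]) ?_, hn⟩
    simp only [pathLevel, hn] at h'
    omega

theorem pathLevel_congr (n : ℕ) {x y : B.PathSpace} (h : ∀ i < n, x.1 i = y.1 i) :
    pathLevel ω n x = pathLevel ω n y := by
  induction n with
  | zero => rfl
  | succ n ih =>
    rw [Nat.forall_lt_succ_right] at h
    simp only [pathLevel, ih h.1, h.2]

variable {ω} {φ : B.PathSpace ≃ₜ B.PathSpace}

theorem IsVershikMap.pathLevel_succ (hφ : IsVershikMap ω φ) {n : ℕ} {x : B.PathSpace}
    (h : pathLevel ω n x + 1 < B.towerHeight n (B.endVtx n x)) :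
    B.endVtx n (φ x) = B.endVtx n x ∧ pathLevel ω n (φ x) = pathLevel ω n x + 1 := by
  have hne := h.ne
  rw [Ne, pathLevel_add_one_eq_iff] at hne
  push Not at hne
  obtain ⟨i, hin, hi⟩ := hne
  obtain ⟨k, h1, h2, h3, h4, h5⟩ := hφ.2 x fun hx => hi (hx i)
  have hki : k ≤ i := not_lt.1 fun hik => hi (h1 i hik)
  have hkn : k + 1 ≤ n := by omega
  clear h hi hin hki
  induction n, hkn using Nat.le_induction with
  | base =>
    have e1 := (pathLevel_add_one_eq_iff ω k x).2 h1
    have e2 := (pathLevel_eq_zero_iff ω k (φ x)).2 h4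
    have e3 := edgeOffset_add_eq_of_isSuccEdge ω h3
    refine ⟨?_, ?_⟩
    · rw [endVtx, endVtx, ← (φ x).2, ← x.2]; exact h3.1
    · rw [endVtx] at e1
      simp only [pathLevel]
      omega
  | succ m hm ih =>
    refine ⟨by rw [endVtx, endVtx, h5 _ (by omega)], ?_⟩
    simp only [pathLevel, ih.2, h5 m (by omega)]
    omega

theorem IsVershikMap.pathLevel_top (hφ : IsVershikMap ω φ) {n : ℕ} {x : B.PathSpace}
    (h : pathLevel ω n x + 1 = B.towerHeight n (B.endVtx n x)) : pathLevel ω n (φ x) = 0 := by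
  rw [pathLevel_add_one_eq_iff] at h
  rw [pathLevel_eq_zero_iff]
  by_cases hx : IsMaxPath ω x
  · have : φ x ∈ {x | IsMinPath ω x} := hφ.1 ▸ ⟨x, hx, rfl⟩
    exact fun i _ => this i
  · obtain ⟨k, -, h2, -, h4, -⟩ := hφ.2 x hx
    exact fun i hi => h4 i (lt_of_lt_of_le hi (not_lt.1 fun hkn => h2 (h k hkn)))

end

theorem continuous_edge (n : ℕ) : Continuous fun x : B.PathSpace => x.1 n :=
  (continuous_apply n).comp continuous_subtype_val

instance (n : ℕ) : DiscreteTopology (B.E n) := ⟨rfl⟩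

instance : T2Space B.PathSpace :=
  inferInstanceAs (T2Space { x : ∀ n, B.E n // ∀ n, B.rng n (x n) = B.src (n + 1) (x (n + 1)) })

theorem eventually_edge_eq (n : ℕ) (x : B.PathSpace) :
    ∀ᶠ y in nhds x, ∀ i < n, y.1 i = x.1 i := by
  refine (Filter.eventually_all_finite (Set.finite_lt_nat n)).2 fun i _ => ?_
  exact ((isOpen_discrete {x.1 i}).preimage (continuous_edge i)).mem_nhds rfl

/-- The tower partition given by the `n`-th level of a Bratteli–Vershik model. -/
noncomputable def towerPartition {X : Type} [TopologicalSpace X] {T : X ≃ₜ X} {ω : B.OrderOn}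
    {φ : B.PathSpace ≃ₜ B.PathSpace} (hφ : IsVershikMap ω φ) (h : X ≃ₜ B.PathSpace)
    (hT : ∀ x, h (T x) = φ (h x)) (n : ℕ) : TowerPartition X T (B.V n) where
  vtx x := B.endVtx n (h x)
  lvl x := pathLevel ω n (h x)
  ht := B.towerHeight n
  isLocallyConstant := by
    rw [IsLocallyConstant.iff_eventually_eq]
    intro x
    filter_upwards [h.continuous.continuousAt.eventually (eventually_edge_eq (n + 1) (h x))]
      with y hy
    rw [pathLevel_congr ω n fun i hi => hy i (by omega), endVtx, endVtx, hy n (by omega)]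
  lvl_lt x := pathLevel_lt ω n _
  vtx_succ x hx := by rw [hT]; exact (hφ.pathLevel_succ hx).1
  lvl_succ x hx := by rw [hT]; exact (hφ.pathLevel_succ hx).2
  lvl_top x hx := by rw [hT]; exact hφ.pathLevel_top hx

end BratteliDiagram

theorem HasBVModelOfRank.exists_hasFineTowers {X : Type} [MetricSpace X] [CompactSpace X]
    {T : X ≃ₜ X} {K : ℕ} (hK : HasBVModelOfRank X T K) : ∃ x₀, HasFineTowers X T x₀ K := by
  obtain ⟨B, hc, ω, -, ⟨m, hm, hmu⟩, φ, hφ, h, hT⟩ := hK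
  refine ⟨h.symm m, fun ε hε => ?_⟩
  have hcont : ∀ n, Continuous fun x : X => (h x).1 n := fun n =>
    (continuous_edge n).comp h.continuous
  obtain ⟨a, ha⟩ : ∃ n, {x : X | ∀ i < n, IsMinEdge ω ((h x).1 i)} ⊆ Metric.ball (h.symm m) ε := by
    have hcl : ∀ n, IsClosed {x : X | ∀ i < n, IsMinEdge ω ((h x).1 i)} := by
      intro n
      simp only [Set.ofPred_forall]
      exact isClosed_iInter fun i => isClosed_iInter fun _ =>
        (isClosed_discrete {e | IsMinEdge ω e}).preimage (hcont i)
    have hanti : Antitone fun n => {x : X | ∀ i < n, IsMinEdge ω ((h x).1 i)} :=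
      fun i j hij x hx k hk => hx k (hk.trans_le hij)
    refine exists_subset_nhds_of_isCompact' (directed_of_isDirected_le hanti)
      (fun n => (hcl n).isCompact) hcl fun x hx => ?_
    have : h x = m := hmu _ fun n => Set.mem_iInter.1 hx (n + 1) n n.lt_succ_self
    rw [← this, Homeomorph.symm_apply_apply]
    exact Metric.ball_mem_nhds _ hε
  obtain ⟨b, hb⟩ : ∃ n, {p : X × X | ∀ i < n, (h p.1).1 i = (h p.2).1 i} ⊆
      {p | dist p.1 p.2 < ε} := by
    have hcl : ∀ n, IsClosed {p : X × X | ∀ i < n, (h p.1).1 i = (h p.2).1 i} := by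
      intro n
      simp only [Set.ofPred_forall]
      exact isClosed_iInter fun i => isClosed_iInter fun _ =>
        isClosed_eq ((hcont i).comp continuous_fst) ((hcont i).comp continuous_snd)
    have hanti : Antitone fun n => {p : X × X | ∀ i < n, (h p.1).1 i = (h p.2).1 i} :=
      fun i j hij x hx k hk => hx k (hk.trans_le hij)
    refine exists_subset_nhds_of_isCompact' (directed_of_isDirected_le hanti)
      (fun n => (hcl n).isCompact) hcl fun p hp => ?_
    have : p.1 = p.2 := h.injective <| Subtype.ext <| funext fun n =>
      Set.mem_iInter.1 hp (n + 1) n n.lt_succ_self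
    refine (isOpen_lt continuous_dist continuous_const).mem_nhds ?_
    rw [Set.mem_ofPred_eq, this, dist_self]
    exact hε
  set n := max (max a b) 1 with hn
  refine ⟨B.V n, inferInstance, towerPartition hφ h hT n, hc n (le_max_right _ _), ?_,
    fun x hx => ha fun i hi => ?_, fun x y h1 h2 => hb (a := (x, y)) fun i hi => ?_⟩
  · simp only [towerPartition, Homeomorph.apply_symm_apply]
    exact (pathLevel_eq_zero_iff ω n m).2 fun i _ => hm i
  · exact (pathLevel_eq_zero_iff ω n (h x)).1 hx i (by omega)
  · exact eq_of_pathLevel_eq ω n h1 h2 i (by omega)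

namespace TowerPartition

variable {X : Type} [TopologicalSpace X] {T : X ≃ₜ X} {V V' : Type}

theorem lvl_add_one_eq (S : TowerPartition X T V) {x : X} (h : S.lvl (T x) = 0) :
    S.lvl x + 1 = S.ht (S.vtx x) := by
  refine le_antisymm (S.lvl_lt x) ?_
  by_contra hlt
  have := S.lvl_succ x (by omega)
  omega

theorem Refines.lvl_le {Q : TowerPartition X T V'} {P : TowerPartition X T V} (h : Q.Refines P)
    (x : X) : P.lvl x ≤ Q.lvl x := by
  by_contra hlt
  have h1 := (Q.down x (Q.lvl x) le_rfl).2
  have h2 := (P.down x (Q.lvl x) (by omega)).2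
  rw [h.2 _ (by omega)] at h2
  omega

theorem Refines.lvl_add_ht_le {Q : TowerPartition X T V'} {P : TowerPartition X T V}
    (h : Q.Refines P) (x : X) : Q.lvl x + P.ht (P.vtx x) ≤ Q.ht (Q.vtx x) + P.lvl x := by
  by_contra hlt
  have h0 := Q.lvl_lt x
  have h1 := (P.up x (Q.ht (Q.vtx x) - Q.lvl x) (by omega)).2
  rw [h.2 _ (Q.lvl_zpow_ht_sub_lvl x)] at h1
  omega

/-- Forget the empty towers of a partition. -/
def restrict (S : TowerPartition X T V) : TowerPartition X T (Set.range S.vtx) where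
  vtx x := ⟨S.vtx x, x, rfl⟩
  lvl := S.lvl
  ht v := S.ht v
  isLocallyConstant := by
    rw [IsLocallyConstant.iff_eventually_eq]
    intro x
    filter_upwards [(IsLocallyConstant.iff_eventually_eq _).1 S.isLocallyConstant x] with y hy
    simp only [Prod.mk.injEq] at hy
    simp only [hy]
  lvl_lt := S.lvl_lt
  vtx_succ x hx := Subtype.ext (S.vtx_succ x hx)
  lvl_succ := S.lvl_succ
  lvl_top := S.lvl_top

/-- The partition with a single tower of height one. -/
def trivial (X : Type) [TopologicalSpace X] (T : X ≃ₜ X) : TowerPartition X T Unit where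
  vtx _ := ()
  lvl _ := 0
  ht _ := 1
  isLocallyConstant := IsLocallyConstant.const _
  lvl_lt _ := Nat.one_pos
  vtx_succ _ _ := rfl
  lvl_succ _ h := absurd h (by simp)
  lvl_top _ _ := rfl

end TowerPartition

/-- A refining sequence of tower partitions that generates the topology, whose bases shrink to the
point `x₀`. -/
structure RefiningSequence (X : Type) [TopologicalSpace X] (T : X ≃ₜ X) (x₀ : X) where
  V : ℕ → Type
  finite : ∀ n, Finite (V n)
  S : ∀ n, TowerPartition X T (V n)
  surj : ∀ n, Function.Surjective (S n).vtx
  refines : ∀ n, (S (n + 1)).Refines (S n)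
  subsingleton : ∀ v w : V 0, v = w
  ht_zero : ∀ v, (S 0).ht v = 1
  lvl_base : ∀ n, (S n).lvl x₀ = 0
  eq_base : ∀ x, (∀ n, (S n).lvl x = 0) → x = x₀
  eq_of_atom : ∀ x y, (∀ n, (S n).atom x = (S n).atom y) → x = y

namespace RefiningSequence

variable {X : Type} [TopologicalSpace X] {T : X ≃ₜ X} {x₀ : X} (R : RefiningSequence X T x₀)

/-- The edges from level `n` to level `n + 1`: the levels of the partition `S (n + 1)` that are
contained in the base of `S n`. -/
def Edge (n : ℕ) : Type :=
  { p : R.V (n + 1) × ℕ // ∃ x, (R.S (n + 1)).atom x = p ∧ (R.S n).lvl x = 0 }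

instance [CompactSpace X] (n : ℕ) : Finite (R.Edge n) := by
  have h : (Set.range (R.S (n + 1)).atom).Finite := (R.S (n + 1)).isLocallyConstant.range_finite
  exact (h.subset fun p ⟨x, hx, _⟩ => ⟨x, hx⟩ :
    {p : R.V (n + 1) × ℕ | ∃ x, (R.S (n + 1)).atom x = p ∧ (R.S n).lvl x = 0}.Finite)

/-- The source of an edge. -/
noncomputable def edgeSrc {n : ℕ} (e : R.Edge n) : R.V n := (R.S n).vtx e.2.choose

variable {R}

theorem edgeSrc_eq {n : ℕ} (e : R.Edge n) {x : X} (hx : (R.S (n + 1)).atom x = e.1) :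
    R.edgeSrc e = (R.S n).vtx x ∧ (R.S n).lvl x = 0 := by
  obtain ⟨h1, h2⟩ := e.2.choose_spec
  have h3 := (R.refines n).1 _ _ (hx.trans h1.symm)
  simp only [TowerPartition.atom, Prod.mk.injEq] at h3
  exact ⟨h3.1.symm, h3.2.trans h2⟩

variable (R)

/-- The edge at level `n` of the path coding `x`. -/
def edge (n : ℕ) (x : X) : R.Edge n :=
  ⟨(R.S (n + 1)).atom ((T.toEquiv ^ (-((R.S n).lvl x : ℤ))) x), _, rfl, by
    have := ((R.S n).down x _ le_rfl).2; omega⟩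

variable {R}

theorem edge_fst (n : ℕ) (x : X) : (R.edge n x).1.1 = (R.S (n + 1)).vtx x :=
  ((R.S (n + 1)).down x _ ((R.refines n).lvl_le x)).1

theorem edge_snd (n : ℕ) (x : X) : (R.edge n x).1.2 + (R.S n).lvl x = (R.S (n + 1)).lvl x :=
  ((R.S (n + 1)).down x _ ((R.refines n).lvl_le x)).2

theorem edgeSrc_edge (n : ℕ) (x : X) : R.edgeSrc (R.edge n x) = (R.S n).vtx x := by
  rw [(edgeSrc_eq (R.edge n x) rfl).1, ((R.S n).down x _ le_rfl).1]

theorem edge_eq_iff {n : ℕ} {e : R.Edge n} {x : X} : R.edge n x = e ↔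
    (R.S (n + 1)).vtx x = e.1.1 ∧ (R.S (n + 1)).lvl x = e.1.2 + (R.S n).lvl x := by
  rw [← edge_fst, ← edge_snd, add_left_inj, ← Prod.ext_iff]
  exact Subtype.ext_iff

theorem lvl_zero (x : X) : (R.S 0).lvl x = 0 := by
  have := (R.S 0).lvl_lt x
  rw [R.ht_zero] at this
  omega

theorem atom_eq_of_atom_succ_eq {n i : ℕ} (hi : i ≤ n) {x y : X}
    (h : (R.S n).atom x = (R.S n).atom y) : (R.S i).atom x = (R.S i).atom y := by
  induction n, hi using Nat.le_induction with
  | base => exact h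
  | succ n _ ih => exact ih ((R.refines n).1 x y h)

theorem lvl_eq_zero_of_le {n i : ℕ} (hi : i ≤ n) {x : X} (h : (R.S n).lvl x = 0) :
    (R.S i).lvl x = 0 := by
  induction n, hi using Nat.le_induction with
  | base => exact h
  | succ n _ ih => exact ih ((R.refines n).2 x h)

theorem lvl_add_one_lt_of_le {n i : ℕ} (hi : i ≤ n) {x : X}
    (h : (R.S i).lvl x + 1 < (R.S i).ht ((R.S i).vtx x)) :
    (R.S n).lvl x + 1 < (R.S n).ht ((R.S n).vtx x) := by
  induction n, hi using Nat.le_induction with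
  | base => exact h
  | succ n _ ih =>
    have := (R.refines n).lvl_add_ht_le x
    omega

theorem edge_congr {n i : ℕ} (hi : i < n) {x y : X} (h : (R.S n).atom x = (R.S n).atom y) :
    R.edge i x = R.edge i y := by
  have h1 := atom_eq_of_atom_succ_eq hi h
  have h2 := atom_eq_of_atom_succ_eq hi.le h
  simp only [TowerPartition.atom, Prod.mk.injEq] at h1 h2
  rw [edge_eq_iff, edge_fst, h1.1, h1.2, h2.2, edge_snd]
  exact ⟨rfl, rfl⟩

theorem isLocallyConstant_edge (n : ℕ) : IsLocallyConstant (R.edge n) := by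
  rw [IsLocallyConstant.iff_eventually_eq]
  intro x
  filter_upwards [(IsLocallyConstant.iff_eventually_eq _).1 (R.S (n + 1)).isLocallyConstant x]
    with y hy
  exact edge_congr n.lt_succ_self hy

/-- The gap between consecutive edges with the same range is the height of the first one. -/
theorem snd_add_ht_le {n : ℕ} {e f : R.Edge n} (hr : f.1.1 = e.1.1) (hlt : e.1.2 < f.1.2) :
    e.1.2 + (R.S n).ht (R.edgeSrc e) ≤ f.1.2 := by
  obtain ⟨x, hx, -⟩ := e.2
  obtain ⟨y, hy, -⟩ := f.2
  obtain ⟨h1, h2⟩ := edgeSrc_eq e hx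
  obtain ⟨-, h3⟩ := edgeSrc_eq f hy
  by_contra hcon
  have h4 := ((R.S n).up x (f.1.2 - e.1.2) (by rw [h2, ← h1]; omega)).2
  have hx1 : (R.S (n + 1)).vtx x = e.1.1 := congrArg Prod.fst hx
  have hx2 : (R.S (n + 1)).lvl x = e.1.2 := congrArg Prod.snd hx
  have hy1 : (R.S (n + 1)).vtx y = f.1.1 := congrArg Prod.fst hy
  have hy2 : (R.S (n + 1)).lvl y = f.1.2 := congrArg Prod.snd hy
  have hlt' := (R.S (n + 1)).lvl_lt y
  obtain ⟨h5, h6⟩ := (R.S (n + 1)).up x (f.1.2 - e.1.2) (by rw [hx1, hx2, ← hr, ← hy1]; omega)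
  have h7 := congrArg Prod.snd ((R.refines n).1 _ y (Prod.ext (h5.trans (hx1.trans (hr.symm.trans
    hy1.symm))) (show _ = (R.S (n + 1)).lvl y by rw [TowerPartition.atom, h6]; omega)))
  simp only [TowerPartition.atom] at h7
  omega

variable (R) [CompactSpace X]

/-- The Bratteli diagram of a refining sequence of tower partitions. -/
noncomputable def bratteli : BratteliDiagram where
  V := R.V
  E := R.Edge
  fintypeV n := @Fintype.ofFinite _ (R.finite n)
  fintypeE n := Fintype.ofFinite _
  nonemptyV n := ⟨(R.S n).vtx x₀⟩
  nonemptyE n := ⟨R.edge n x₀⟩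
  root_subsingleton := R.subsingleton
  src n := R.edgeSrc
  rng n e := e.1.1
  src_surj n v := by
    obtain ⟨x, rfl⟩ := R.surj n v
    exact ⟨R.edge n x, edgeSrc_edge n x⟩
  rng_surj n v := by
    obtain ⟨x, rfl⟩ := R.surj (n + 1) v
    exact ⟨R.edge n x, edge_fst n x⟩

/-- Edges are ordered as the levels of the towers are. -/
noncomputable def order : R.bratteli.OrderOn := fun _ _ =>
  LinearOrder.lift' (fun e => Prod.snd (Subtype.val (Subtype.val e))) fun e f h =>
    Subtype.ext (Subtype.ext (Prod.ext (e.2.trans f.2.symm) h))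

/-- The path coding a point. -/
def path (x : X) : R.bratteli.PathSpace :=
  ⟨fun n => R.edge n x, fun n => (edge_fst n x).trans (edgeSrc_edge (n + 1) x).symm⟩

variable {R}

theorem path_injective : Function.Injective R.path := by
  intro x y hxy
  have he : ∀ n, R.edge n x = R.edge n y := fun n => congrFun (congrArg Subtype.val hxy) n
  refine R.eq_of_atom x y fun n => ?_
  have hl : (R.S n).lvl x = (R.S n).lvl y := by
    induction n with
    | zero => rw [lvl_zero, lvl_zero]
    | succ n ih => rw [← edge_snd, ← edge_snd, he, ih]
  cases n with
  | zero => exact Prod.ext (R.subsingleton _ _) hl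
  | succ n => exact Prod.ext (by simp only [TowerPartition.atom, ← edge_fst, he]) hl

theorem path_continuous : Continuous R.path :=
  Continuous.subtype_mk (continuous_pi fun n =>
    IsLocallyConstant.continuous (Y := R.bratteli.E n) (isLocallyConstant_edge n)) _

theorem path_surjective : Function.Surjective R.path := by
  intro p
  have hne : ∀ n, ∃ x, (R.S n).vtx x = R.edgeSrc (p.1 n) ∧ ∀ i < n, R.edge i x = p.1 i := by
    intro n
    induction n with
    | zero =>
      obtain ⟨x, hx⟩ := R.surj 0 (R.edgeSrc (p.1 0))
      exact ⟨x, hx, by simp⟩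
    | succ n ih =>
      obtain ⟨x, hx, hxi⟩ := ih
      obtain ⟨z, hz, -⟩ := (p.1 n).2
      obtain ⟨h1, h2⟩ := edgeSrc_eq (p.1 n) hz
      obtain ⟨h3, h4⟩ := (R.S n).up z ((R.S n).lvl x)
        (by rw [h2, zero_add, ← h1, ← hx]; exact (R.S n).lvl_lt x)
      set y := (T.toEquiv ^ ((R.S n).lvl x : ℤ)) z with hy
      rw [← h1, ← hx] at h3
      rw [h2, zero_add] at h4
      have hen : R.edge n y = p.1 n := by
        refine Subtype.ext ?_
        have : (R.S (n + 1)).atom ((T.toEquiv ^ (-((R.S n).lvl y : ℤ))) y) = (p.1 n).1 := by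
          rw [← hz, h4, hy, ← homeomorph_zpow_add, neg_add_cancel, zpow_zero]
          rfl
        exact this
      refine ⟨y, ?_, Nat.forall_lt_succ_right.2 ⟨fun i hi => ?_, hen⟩⟩
      · rw [← edge_fst, hen]; exact p.2 n
      · rw [← hxi i hi]
        exact edge_congr hi (Prod.ext h3 h4)
  have hcl : ∀ n, IsClosed {x | ∀ i < n, R.edge i x = p.1 i} := by
    intro n
    simp only [Set.ofPred_forall]
    exact isClosed_iInter fun i => isClosed_iInter fun _ =>
      (isLocallyConstant_edge i).isClosed_fiber (p.1 i)
  have hanti : Antitone fun n => {x | ∀ i < n, R.edge i x = p.1 i} :=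
    fun i j hij x hx k hk => hx k (lt_of_lt_of_le hk hij)
  obtain ⟨x, hx⟩ := IsCompact.nonempty_iInter_of_directed_nonempty_isCompact_isClosed _
    (directed_of_isDirected_le hanti) (fun n => (hne n).imp fun x hx => hx.2)
    (fun n => (hcl n).isCompact) hcl
  exact ⟨x, Subtype.ext (funext fun n => Set.mem_iInter.1 hx (n + 1) n n.lt_succ_self)⟩

/-- The coding of points by paths, as a homeomorphism. -/
noncomputable def pathHomeomorph (R : RefiningSequence X T x₀) : X ≃ₜ R.bratteli.PathSpace :=
  path_continuous.homeoOfEquivCompactToT2 (f := Equiv.ofBijective R.path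
    ⟨path_injective, path_surjective⟩)

theorem isMinEdge_iff {n : ℕ} (e : R.Edge n) :
    IsMinEdge (B := R.bratteli) R.order (n := n) e ↔ e.1.2 = 0 := by
  constructor
  · intro h
    obtain ⟨x, hx⟩ := R.surj (n + 1) e.1.1
    obtain ⟨h1, h2⟩ := (R.S (n + 1)).down x _ le_rfl
    set y := (T.toEquiv ^ (-((R.S (n + 1)).lvl x : ℤ))) x
    have h3 : (R.S (n + 1)).lvl y = 0 := by omega
    have h4 : e.1.2 ≤ (R.edge n y).1.2 := h ⟨R.edge n y, (edge_fst n y).trans (h1.trans hx)⟩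
    have h5 := edge_snd (R := R) n y
    omega
  · intro h e'
    have : e.1.2 ≤ e'.1.1.2 := h.le.trans (Nat.zero_le _)
    exact this

theorem isMaxEdge_iff {n : ℕ} (x : X) :
    IsMaxEdge (B := R.bratteli) R.order (n := n) (R.edge n x) ↔
      (R.S (n + 1)).lvl x + (R.S n).ht ((R.S n).vtx x) =
        (R.S (n + 1)).ht ((R.S (n + 1)).vtx x) + (R.S n).lvl x := by
  have h0 := edge_snd (R := R) n x
  have hle := (R.refines n).lvl_add_ht_le x
  constructor
  · intro h
    refine le_antisymm hle ?_
    by_contra hlt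
    have hx := (R.S n).lvl_lt x
    obtain ⟨h1, h2⟩ := (R.S (n + 1)).up x ((R.S n).ht ((R.S n).vtx x) - (R.S n).lvl x) (by omega)
    have h3 := (R.S n).lvl_zpow_ht_sub_lvl x
    set y := (T.toEquiv ^ (((R.S n).ht ((R.S n).vtx x) - (R.S n).lvl x : ℕ) : ℤ)) x
    have h4 : (R.edge n y).1.2 ≤ (R.edge n x).1.2 :=
      h ⟨R.edge n y, (edge_fst n y).trans (h1.trans (edge_fst n x).symm)⟩
    have h5 := edge_snd (R := R) n y
    omega
  · intro h e'
    have : e'.1.1.2 ≤ (R.edge n x).1.2 := by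
      by_contra hlt
      have hr : e'.1.1.1 = (R.edge n x).1.1 := e'.2
      have h1 := snd_add_ht_le hr (not_le.1 hlt)
      rw [edgeSrc_edge] at h1
      obtain ⟨y, hy, -⟩ := e'.1.2
      have h2 := (R.S (n + 1)).lvl_lt y
      rw [show (R.S (n + 1)).lvl y = e'.1.1.2 from congrArg Prod.snd hy,
        show (R.S (n + 1)).vtx y = e'.1.1.1 from congrArg Prod.fst hy, hr, edge_fst] at h2
      omega
    exact this

theorem isMaxPath_iff (x : X) : IsMaxPath R.order (R.path x) ↔ T x = x₀ := by
  constructor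
  · intro h
    refine R.eq_base _ fun n => (R.S n).lvl_top x ?_
    induction n with
    | zero => rw [lvl_zero, R.ht_zero]
    | succ n ih =>
      have := (isMaxEdge_iff x).1 (h n)
      omega
  · intro h n
    have h1 := (R.S n).lvl_add_one_eq (x := x) (h ▸ R.lvl_base n)
    have h2 := (R.S (n + 1)).lvl_add_one_eq (x := x) (h ▸ R.lvl_base (n + 1))
    refine (isMaxEdge_iff x).2 ?_
    omega

theorem isMinPath_iff (x : X) : IsMinPath R.order (R.path x) ↔ x = x₀ := by
  constructor
  · intro h
    refine R.eq_base _ fun n => ?_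
    induction n with
    | zero => exact lvl_zero x
    | succ n ih => rw [← edge_snd, ih, (isMinEdge_iff (R.edge n x)).1 (h n)]
  · rintro rfl n
    refine (isMinEdge_iff (R.edge n x)).2 ?_
    have h₁ := edge_snd (R := R) n x
    have h₂ := R.lvl_base n
    have h₃ := R.lvl_base (n + 1)
    omega

/-- The homeomorphism of the path space corresponding to `T`. -/
noncomputable def vershik (R : RefiningSequence X T x₀) :
    R.bratteli.PathSpace ≃ₜ R.bratteli.PathSpace :=
  (R.pathHomeomorph.symm.trans T).trans R.pathHomeomorph

theorem vershik_path (x : X) : R.vershik (R.path x) = R.path (T x) := by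
  have : R.pathHomeomorph.symm (R.path x) = x := R.pathHomeomorph.symm_apply_apply x
  simp only [vershik, Homeomorph.trans_apply, this]
  rfl

theorem isVershikMap : IsVershikMap R.order R.vershik := by
  constructor
  · ext p
    obtain ⟨y, rfl⟩ := path_surjective p
    constructor
    · rintro ⟨q, hq, hqy⟩
      obtain ⟨x, rfl⟩ := path_surjective q
      rw [vershik_path] at hqy
      exact (isMinPath_iff y).2 ((path_injective hqy).symm.trans ((isMaxPath_iff x).1 hq))
    · intro hy
      have hy' := (isMinPath_iff y).1 hy
      refine ⟨R.path (T.symm y), (isMaxPath_iff _).2 ?_, ?_⟩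
      · rw [T.apply_symm_apply, hy']
      · rw [vershik_path, T.apply_symm_apply]
  · intro p hp
    classical
    obtain ⟨x, rfl⟩ := path_surjective p
    rw [vershik_path]
    have hex : ∃ k, ¬ IsMaxEdge (B := R.bratteli) R.order (n := k) (R.edge k x) := by
      by_contra! h
      exact hp h
    have hlt : ∀ i < Nat.find hex, IsMaxEdge (B := R.bratteli) R.order (n := i) (R.edge i x) :=
      fun i hi => not_not.1 (Nat.find_min hex hi)
    have hk := Nat.find_spec hex
    set k := Nat.find hex
    have htop : ∀ i ≤ k, (R.S i).lvl x + 1 = (R.S i).ht ((R.S i).vtx x) := by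
      intro i hi
      induction i with
      | zero => rw [lvl_zero, R.ht_zero]
      | succ i ih =>
        have h1 := (isMaxEdge_iff x).1 (hlt i hi)
        have h2 := ih (by omega)
        omega
    have hzero := (R.S k).lvl_top x (htop k le_rfl)
    have hlow : (R.S (k + 1)).lvl x + 1 < (R.S (k + 1)).ht ((R.S (k + 1)).vtx x) := by
      have h1 := (R.refines k).lvl_add_ht_le x
      rw [isMaxEdge_iff] at hk
      have h2 := htop k le_rfl
      omega
    have hv := (R.S (k + 1)).vtx_succ x hlow
    have hl := (R.S (k + 1)).lvl_succ x hlow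
    have hr : (R.edge k (T x)).1.1 = (R.edge k x).1.1 := by rw [edge_fst, edge_fst, hv]
    have hs : (R.edge k (T x)).1.2 = (R.edge k x).1.2 + (R.S k).ht (R.edgeSrc (R.edge k x)) := by
      have h1 := edge_snd (R := R) k (T x)
      have h2 := edge_snd (R := R) k x
      have h3 := htop k le_rfl
      rw [edgeSrc_edge]
      omega
    refine ⟨k, hlt, hk, ⟨hr, ?_, fun f hf => ?_⟩, fun i hi => (isMinEdge_iff (R.edge i (T x))).2 ?_,
      fun i hi => edge_eq_iff.2 ?_⟩
    · have : (R.edge k x).1.2 < (R.edge k (T x)).1.2 := by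
        rw [hs, edgeSrc_edge]
        have := (R.S k).lvl_lt x
        omega
      exact this
    · have hf' : (R.edge k x).1.2 < f.1.1.2 := hf
      have : (R.edge k (T x)).1.2 ≤ f.1.1.2 := hs ▸ snd_add_ht_le f.2 hf'
      exact this
    · have h1 := lvl_eq_zero_of_le (show i + 1 ≤ k from hi) hzero
      have h2 := edge_snd (R := R) i (T x)
      omega
    · have h1 := lvl_add_one_lt_of_le (show k + 1 ≤ i from hi) hlow
      have h2 := lvl_add_one_lt_of_le (Nat.le_succ i) h1
      rw [(R.S (i + 1)).vtx_succ x h2, (R.S (i + 1)).lvl_succ x h2, (R.S i).lvl_succ x h1]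
      have h3 := edge_fst (R := R) i x
      have h4 := edge_snd (R := R) i x
      exact ⟨h3.symm, by rw [← h4]; rfl⟩

theorem hasBVModelOfRank {K : ℕ} (R : RefiningSequence X T x₀)
    (hK : ∀ n, 1 ≤ n → Nat.card (R.V n) ≤ K) : HasBVModelOfRank X T K := by
  refine ⟨R.bratteli, hK, R.order, ⟨R.path (T.symm x₀), (isMaxPath_iff _).2 (by simp), ?_⟩,
    ⟨R.path x₀, (isMinPath_iff _).2 rfl, ?_⟩, R.vershik, isVershikMap, R.pathHomeomorph,
    fun x => (vershik_path x).symm⟩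
  · intro p hp
    obtain ⟨x, rfl⟩ := path_surjective p
    exact congrArg R.path (T.eq_symm_apply.2 ((isMaxPath_iff x).1 hp))
  · intro p hp
    obtain ⟨x, rfl⟩ := path_surjective p
    exact congrArg R.path ((isMinPath_iff x).1 hp)

end RefiningSequence

theorem HasFineTowers.hasBVModelOfRank {X : Type} [MetricSpace X] [CompactSpace X] {T : X ≃ₜ X}
    {x₀ : X} {K : ℕ} (h : HasFineTowers X T x₀ K) : HasBVModelOfRank X T K := by
  have hnext : ∀ (s : Σ V : Type, {S : TowerPartition X T V // S.lvl x₀ = 0}) (n : ℕ),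
      ∃ s' : Σ V : Type, {S : TowerPartition X T V // S.lvl x₀ = 0}, Finite s'.1 ∧
        Nat.card s'.1 ≤ K ∧ Function.Surjective s'.2.1.vtx ∧ s'.2.1.Refines s.2.1 ∧
        (∀ x, s'.2.1.lvl x = 0 → dist x x₀ < 1 / (n + 1)) ∧
        ∀ x y, s'.2.1.atom x = s'.2.1.atom y → dist x y < 1 / (n + 1) := by
    rintro ⟨V, S, hS⟩ n
    obtain ⟨V', hV', Q, hc, hQ0, hQ, hb, ha⟩ :=
      h.exists_refines S hS (Nat.one_div_pos_of_nat (α := ℝ) (n := n))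
    have hat : ∀ x y, Q.restrict.atom x = Q.restrict.atom y → Q.atom x = Q.atom y := by
      intro x y hxy
      have h1 : Q.vtx x = Q.vtx y := congrArg (fun p => (Prod.fst p).1) hxy
      have h2 : Q.lvl x = Q.lvl y := congrArg Prod.snd hxy
      exact Prod.ext h1 h2
    refine ⟨⟨Set.range Q.vtx, Q.restrict, hQ0⟩, inferInstance, ?_, ?_,
      ⟨fun x y hxy => hQ.1 _ _ (hat x y hxy), hQ.2⟩, hb, fun x y hxy => ha x y (hat x y hxy)⟩
    · exact (Nat.card_le_card_of_injective _ Subtype.val_injective).trans hc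
    · rintro ⟨_, x, rfl⟩; exact ⟨x, rfl⟩
  choose next hfin hcard hsurj href hbase hatom using hnext
  let s : ℕ → Σ V : Type, {S : TowerPartition X T V // S.lvl x₀ = 0} := fun n =>
    Nat.rec ⟨Unit, TowerPartition.trivial X T, rfl⟩ (fun n s => next s n) n
  have hzero : ∀ a : ℝ, 0 ≤ a → (∀ n : ℕ, a < 1 / (n + 1)) → a = 0 := by
    intro a ha h
    by_contra hne
    obtain ⟨n, hn⟩ := exists_nat_one_div_lt (lt_of_le_of_ne ha (Ne.symm hne))
    exact lt_asymm hn (h n)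
  let R : RefiningSequence X T x₀ :=
    { V := fun n => (s n).1
      finite := fun n => match n with
        | 0 => inferInstanceAs (Finite Unit)
        | n + 1 => hfin (s n) n
      S := fun n => (s n).2.1
      surj := fun n => match n with
        | 0 => fun _ => ⟨x₀, rfl⟩
        | n + 1 => hsurj (s n) n
      refines := fun n => href (s n) n
      subsingleton := fun _ _ => rfl
      ht_zero := fun _ => rfl
      lvl_base := fun n => (s n).2.2
      eq_base := fun x hx => dist_eq_zero.1 (hzero _ dist_nonneg fun n =>
        hbase (s n) n x (hx (n + 1)))
      eq_of_atom := fun x y hxy => dist_eq_zero.1 (hzero _ dist_nonneg fun n =>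
        hatom (s n) n x y (hxy (n + 1))) }
  refine R.hasBVModelOfRank fun n hn => ?_
  obtain ⟨n, rfl⟩ := Nat.exists_eq_succ_of_ne_zero (by omega : n ≠ 0)
  exact hcard (s n) n

/-- **Downarowicz–Maass.** Every minimal Cantor dynamical system of finite topological
rank `d > 1` is expansive. -/
theorem minimal_finite_topological_rank_expansive
    (X : Type) [MetricSpace X] [CompactSpace X] [TotallyDisconnectedSpace X]
    [PerfectSpace X] [Nonempty X]
    (T : X ≃ₜ X)
    (hmin : ∀ x : X, Dense (Set.range fun n : ℤ => (T.toEquiv ^ n) x))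
    (d : ℕ) (hd : 1 < d)
    (hrank_le : HasBVModelOfRank X T d)
    (hrank_least : ∀ K : ℕ, 0 < K → HasBVModelOfRank X T K → d ≤ K) :
    ∃ δ : ℝ, 0 < δ ∧ ∀ x y : X, x ≠ y →
      ∃ m : ℤ, δ < dist ((T.toEquiv ^ m) x) ((T.toEquiv ^ m) y) := by
  obtain ⟨x₀, h⟩ := hrank_le.exists_hasFineTowers
  refine h.expansive hmin (fun h' => ?_) fun h' => ?_
  · have := hrank_least (d - 1) (by omega) h'.hasBVModelOfRank
    omega
  · have := hrank_least 1 one_pos h'.hasBVModelOfRank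
    omega
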